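/- arXiv:2201.04889 — 2 statements merged into one kernel-verified Lean document; each statement's English description precedes it below -/
import Mathlib

section
/- Let 6 ≤ n ≤ 15. Then the complement of C_n² contains (a copy of) every graph F on n vertices with n−3 edges, unless F contains one of the graphs in the family F_n as a subgraph, where: F_6 = {S_3}; F_7 = {S_4, C_4, K_3}; F_8 = {K_3, S_5}; F_9 = {K_4⁻, S_6, F_5}; F_10 = {K_4, S_7, S_{5,2}}; F_11 = {K_4, S_8}; F_12 = {K_5⁻, S_9}; F_13 = {S_10, K_5}; F_14 = {S_11, K_5}; F_15 = {S_12}. -/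
/-- The 2-power `Cₙ²` of the cycle on `n` vertices: vertices are `ZMod n`, with
two distinct vertices adjacent iff their (cyclic) distance on the cycle is at most 2. -/
def cycleSq (n : ℕ) : SimpleGraph (ZMod n) :=
  SimpleGraph.fromRel (fun u v => v - u = 1 ∨ v - u = 2)

/-- `Contains G F`: the graph `G` contains a (not necessarily induced) copy of `F`. -/
def Contains {V W : Type*} (G : SimpleGraph V) (F : SimpleGraph W) : Prop :=
  ∃ f : W ↪ V, ∀ ⦃a b⦄, F.Adj a b → G.Adj (f a) (f b)

/-- The star `S_m` on `m` vertices, with center `0`. -/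
def starG (m : ℕ) : SimpleGraph (Fin m) :=
  SimpleGraph.fromRel (fun u _ => u.val = 0)

/-- The cycle `C_m` on `m` vertices. -/
def cyc (m : ℕ) : SimpleGraph (ZMod m) :=
  SimpleGraph.fromRel (fun u v => v - u = 1)

/-- `K_m⁻`: the complete graph on `m` vertices minus one edge (the edge `{0,1}`). -/
def Kminus (m : ℕ) : SimpleGraph (Fin m) :=
  (⊤ : SimpleGraph (Fin m)) \ SimpleGraph.fromRel (fun u v => u.val = 0 ∧ v.val = 1)

/-- `S_{m,k}`: `K_k` joined completely to `m − k` independent vertices (vertices `0,…,k-1`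
form the `K_k`). -/
def joinStar (m k : ℕ) : SimpleGraph (Fin m) :=
  SimpleGraph.fromRel (fun u _ => u.val < k)

/-- `F_5`: two triangles `{0,1,2}` and `{0,3,4}` sharing the single common vertex `0`. -/
def bowtie : SimpleGraph (Fin 5) :=
  SimpleGraph.fromRel (fun u v => u.val = 0 ∨ (u.val = 1 ∧ v.val = 2) ∨ (u.val = 3 ∧ v.val = 4))

namespace CycleSqPacking

/-! ### Arrangements and patterns -/

/-- A cyclic arrangement of the vertices of `F` (an `n`-periodic sequence enumerating them) in which
vertices at cyclic distance at most 2 are never adjacent in `F`. -/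
def IsPackable {n : ℕ} (F : SimpleGraph (Fin n)) : Prop :=
  ∃ p : ℕ → Fin n, Function.Periodic p n ∧ Set.InjOn p {i | i < n} ∧
    ∀ i, ¬ F.Adj (p i) (p (i + 1)) ∧ ¬ F.Adj (p i) (p (i + 2))

/-- A pattern `(m, es)` is the graph on the vertices `0, …, m - 1` with edge list `es`. -/
abbrev Pattern := ℕ × List (ℕ × ℕ)

/-- `F` contains a copy of the pattern `P`. -/
def HasPattern {n : ℕ} (F : SimpleGraph (Fin n)) (P : Pattern) : Prop :=
  ∃ f : Fin P.1 → Fin n, Function.Injective f ∧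
    ∀ e ∈ P.2, ∃ a b : Fin P.1, (a : ℕ) = e.1 ∧ (b : ℕ) = e.2 ∧ F.Adj (f a) (f b)

/-- The star on `m` vertices. -/
def starPattern (m : ℕ) : Pattern := (m, (List.range (m - 1)).map fun i => (0, i + 1))

/-- The forbidden patterns for graphs on `n` vertices; a single edge is the one for `n = 5`. -/
def family : ℕ → List Pattern
  | 5 => [(2, [(0, 1)])]
  | 6 => [starPattern 3]
  | 7 => [starPattern 4, (4, [(0, 1), (1, 2), (2, 3), (0, 3)]), (3, [(0, 1), (0, 2), (1, 2)])]
  | 8 => [(3, [(0, 1), (0, 2), (1, 2)]), starPattern 5]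
  | 9 => [(4, [(0, 2), (0, 3), (1, 2), (1, 3), (2, 3)]), starPattern 6,
      (5, [(0, 1), (0, 2), (0, 3), (0, 4), (1, 2), (3, 4)])]
  | 10 => [(4, [(0, 1), (0, 2), (0, 3), (1, 2), (1, 3), (2, 3)]), starPattern 7,
      (5, [(0, 1), (0, 2), (0, 3), (0, 4), (1, 2), (1, 3), (1, 4)])]
  | 11 => [(4, [(0, 1), (0, 2), (0, 3), (1, 2), (1, 3), (2, 3)]), starPattern 8]
  | 12 => [(5, [(0, 2), (0, 3), (0, 4), (1, 2), (1, 3), (1, 4), (2, 3), (2, 4), (3, 4)]),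
      starPattern 9]
  | 13 => [starPattern 10,
      (5, [(0, 1), (0, 2), (0, 3), (0, 4), (1, 2), (1, 3), (1, 4), (2, 3), (2, 4), (3, 4)])]
  | 14 => [starPattern 11,
      (5, [(0, 1), (0, 2), (0, 3), (0, 4), (1, 2), (1, 3), (1, 4), (2, 3), (2, 4), (3, 4)])]
  | 15 => [starPattern 12]
  | _ => []

/-! ### Executable search

Unordered pairs of vertices below 16 are encoded as numbers, sets of pairs as bit masks, and
arrangements as numbers whose base-16 digits list the vertices. -/

/-- The code of an unordered pair. -/
def pairCode (u v : ℕ) : ℕ := bif Nat.ble u v then 16 * u + v else 16 * v + u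

/-- The bit mask of a list of codes. -/
def toMask : List ℕ → ℕ
  | [] => 0
  | c :: cs => toMask cs ||| 1 <<< c

/-- The vertex at position `i` of the arrangement `a`. -/
def vertexAt (a i : ℕ) : ℕ := a / 16 ^ i % 16

/-- The codes of the pairs at cyclic distance at most 2 in the arrangement `a`. -/
def closePairs (n a : ℕ) : List ℕ :=
  (List.range n).flatMap fun i =>
    [pairCode (vertexAt a i) (vertexAt a ((i + 1) % n)),
      pairCode (vertexAt a i) (vertexAt a ((i + 2) % n))]

/-- The number `a` encodes an arrangement of `0, …, n - 1`. -/
def isArrangement (n a : ℕ) : Bool :=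
  (List.range n).all (fun i => Nat.blt (vertexAt a i) n) &&
    decide ((List.range n).map (vertexAt a)).Nodup

/-- Decide the pairs in the list one after the other, where `E` and `N` are the masks of the
known edges and the known non-edges. -/
def branch (go : ℕ → ℕ → Bool) (E : ℕ) : List ℕ → ℕ → Bool
  | [], _ => true
  | c :: cs, N =>
    bif Nat.beq (Nat.land (Nat.shiftRight N c) 1) 1 then branch go E cs N
    else go (Nat.lor E (Nat.shiftLeft 1 c)) N && branch go E cs (Nat.lor N (Nat.shiftLeft 1 c))

/-- Depth-first search through the graphs with at most `r` edges besides those in `E`: pick an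
arrangement from the table that is compatible with `E`, and branch on its close pairs. If there is
none, `leaf E` decides. The table lists each arrangement's close pairs and their mask. -/
def search (leaf : ℕ → Bool) : ℕ → List (ℕ × List ℕ) → ℕ → ℕ → Bool
  | 0, table, E, _ =>
    match table.filter fun t => Nat.beq (Nat.land t.1 E) 0 with
    | [] => leaf E
    | _ :: _ => true
  | r + 1, table, E, N =>
    match table.filter fun t => Nat.beq (Nat.land t.1 E) 0 with
    | [] => leaf E
    | t :: ts => branch (search leaf r (t :: ts)) E t.2 N

/-- The edge mask of the copy of `P` whose vertices are the base-16 digits of `a`. -/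
def copyMask (P : Pattern) (a : ℕ) : ℕ :=
  toMask (P.2.map fun e => pairCode (vertexAt a e.1) (vertexAt a e.2))

/-- The first `P.1` base-16 digits of `a` can serve as the vertices of a copy of `P`. -/
def isCopy (n : ℕ) (P : Pattern) (a : ℕ) : Bool :=
  (List.range P.1).all (fun i => Nat.blt (vertexAt a i) n) &&
    decide ((List.range P.1).map (vertexAt a)).Nodup &&
    P.2.all fun e => Nat.blt e.1 P.1 && Nat.blt e.2 P.1

/-- Search through the graphs on `n` vertices with at most `n - 3` edges that contain the edges
`es`, have no edges outside the first `s` vertices, and contain none of the listed copies. -/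
def run (n s : ℕ) (es : List (ℕ × ℕ)) (arrs : List ℕ) (copies : List (Pattern × ℕ)) : Bool :=
  search (fun E => (copies.map fun t => copyMask t.1 t.2).any fun M => Nat.beq (Nat.land M E) M)
    (n - 3 - (es.map fun e => pairCode e.1 e.2).dedup.length)
    (arrs.map fun a => (toMask (closePairs n a), closePairs n a))
    (toMask (es.map fun e => pairCode e.1 e.2))
    (toMask ((List.range 256).filter fun c => Nat.ble s (c % 16)))

/-- Base-16 encoded arrangements of `n` vertices that suffice for the searches below. -/
def hints : ℕ → List ℕ
  | 6 => [
    5514000, 1200195, 1196115, 1265700]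
  | 7 => [
    106112016, 106107936, 106050576, 34889811, 19087446, 34947171, 34877541, 34947126, 34824276,
    19284021, 35008596, 34885686, 19214436, 19161171, 19284051, 19087461, 19226691, 34816086,
    35016756]
  | 8 => [
    1984123408, 1984107808, 1984042288, 1935807808, 1952585008, 1919161648, 1919096128,
    1935938848, 1952650528, 1984111888, 1984050448, 1952593168, 1952654608, 1983005968,
    1935820048, 1935942928, 1919108368, 1919169808, 840331348, 588730468, 321155173, 588607558,
    824471638, 557080693, 824524918, 557269078, 588734548, 557084773, 557273188, 321347653,
    827596903, 828710983, 326443108, 828637783, 323428453, 41292628]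
  | 9 => [
    35776570896, 35776566816, 35776501296, 35759724096, 35491288656, 35759662656, 35491227216,
    19448075856, 23743043136, 35239630416, 35776439856, 35239568976, 15154157136, 35524781616,
    35256346176, 18126870096, 35256407616, 15155205696, 22421837376, 35524843056, 19450172976,
    22690272816, 23744091696, 35743077936, 35743012416, 34971260496, 35776443936, 35759670816,
    10859255376, 35524785696, 35491239456, 17858500176, 35474576976, 10860303936, 34988037696,
    22153467456, 35206272576, 35206207056, 35256354336, 35239581216, 34954548816, 13563598416,
    34954614336, 13563663936, 34971391536, 17858631216, 35474708016, 34988103216, 22153532976,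
    10860369456, 35256538656, 35239826976, 15155336736, 35759855136, 22421968416, 35491485216,
    18127066656, 35524908576, 22690338336, 19450238496, 23744157216, 34988111376, 34988049936,
    34971276816, 34954626576, 35776509456, 35759736336, 35743086096, 34954565136, 36309198096,
    35524851216, 35491304976, 35474716176, 35474593296, 36325975056, 35743024656, 19448096016,
    23743063056, 35256419856, 35239646736, 35206284816, 35206223376, 35486393616, 35754828816,
    35206353936, 36327023376, 35771605776, 35474789136, 23744111376, 35743220496, 19450192656,
    15155225616, 35491489296, 35759859216, 35256542736, 35239831056, 15155340816, 36326228496,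
    35772654096, 35759997456, 35491566096, 10860377616, 35524912656, 19450242576, 35776770576,
    23744161296, 36327088656, 5421563991, 5169971301, 9715409016, 9463758951, 9463881816,
    10252419156, 10252284036, 10252402821, 10252472436, 5690122356, 10789281876, 5690048616,
    1176731991, 9514090596, 10284908931, 6495363156, 10049978691, 2215981686, 10520715396,
    9480585336, 10268921976, 6042234996, 6277050501, 5992104051, 5472006231, 5975011461,
    9765879891, 5740118151, 10034360391, 5740130376, 10839474231, 6025461891, 6545424471,
    6545567811, 6025658451, 10570977411, 5706580071, 6511874166, 1697149236, 1930773126,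
    5773869111, 908411256, 6025330776, 875057511, 1663582551, 10251354501, 1663517061,
    9513091416, 9982853511, 1746358851, 1176863091, 10050875526, 10268135736, 10033004871,
    1982353716, 890532486, 6562201686, 1193640246, 10000498791, 10553409891, 10805792886,
    5975265411, 2267365686, 5503148661, 1158906471, 924222021, 6493266501, 1662354036,
    6512140371, 9799422006, 17501225061, 13977870456, 17737085061, 4886724726, 13993599096,
    17485361286, 5138378886, 5169893496, 17501085816, 8929050711, 8929038471, 17501159541,
    9416691846, 17737089111, 17737142406, 13993726056, 5405835351, 13993672791, 4886913141]
  | 10 => [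
    653764219920, 653764203840, 653681628480, 247001912640, 653495833920, 169974698070,
    246461829240, 237603524760, 559507136535, 161331180420, 229798011540, 156824306025,
    164341551255, 156499534680, 225755624070, 632772128790, 177760371060, 225234739800,
    173679395685, 5976199800, 224697684615, 230066254440, 233272013460, 6546866775,
    238656307845, 70753079940, 6814126980, 6042502005, 71272190820, 5774066550, 5522350965,
    296909963385, 211566559335, 288070656135, 227971522680, 361366065255, 86744010855,
    78439280745, 143146848390, 224715628665, 150680793240, 159787683960, 348735967350,
    296674103430, 159740559465, 228726505590, 223897809030, 228238778505, 151734751335,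
    283823739015, 155981349015, 348767412345, 349019074710, 82984800390, 142627803240,
    281641635960, 152224301205, 285667319925, 216427745415]
  | 11 => [
    11633039664400, 11631718438480, 5124743698000, 4025500505680, 5124574615120, 4025063052880,
    2926005655120, 2925819860560, 2926088230480, 11631450068560, 11627155166800, 5124842985040,
    4025599792720, 11631718458640, 11628745745680, 6748490014855, 6675792109705, 3596533407865,
    4488882065530, 4488834883735, 5661892702360, 5584051474570, 6687871701160, 3389843476615,
    4819781185705, 2488482295960, 5798511616135, 6808132948135, 5593174085800, 6950131236985,
    4481096392855, 2290899054730, 2294909804665, 5927895470200, 1826487816295, 1680175960165,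
    374254174570, 714075373975]
  | 12 => [
    204872493463056, 100760897591136, 100760629221216, 100756334319456, 83164148340576,
    100760781592416, 199261829994336, 198162586802016, 47988803639136, 92615107680096,
    197131794650976, 74467528677216, 196100750841696, 90959951435616, 197200245692256,
    92059446286176, 198093884102496, 65580972906336, 92546404980576, 196032299800416,
    73368033826656, 198299488884576, 93158689478496, 195963597100896, 199330281035616,
    195963345442656, 196994389251936, 83172890515296, 91446910130016, 199330029377376,
    196994137593696, 73854740862816, 204870788847456, 47984339654496, 198163659429456,
    74466839566176, 65576257263456, 198094956729936, 73367596373856, 196995461879376,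
    55775678764896, 204823542962016, 47988634556256, 197539109606976, 197539109541456,
    196439866414656, 199263171057216, 65569526388576, 92059025545056, 65580552165216,
    196439866349136, 199194468357696, 47981635311456, 90959782352736, 196995478656576,
    55775947134816, 204892262373216, 204892010714976, 204866341574496, 204754605315936,
    204797622163296, 204726466778976, 47988902926176, 199331890533936, 83172738144096,
    199194485134896, 90960050722656, 198638621234736, 198638621103696, 196440134850096,
    83161712367456, 204824883959376, 47985930213216, 199738132796976, 199738132731456,
    196440403220016, 100753897363296, 204687492192096, 204863904618336, 204893603436096,
    198094990284336, 196440403154496, 47990224131936, 73368133113696, 204892530743136,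
    204755360290656, 204892027426656, 204795186190176, 204870636476256, 83173006514016,
    65581088905056, 199331907311136, 199263204611616, 198638889670176, 198638889473616,
    197539646477856, 197539646281296, 83166007269216, 65578116192096, 199738401232416,
    199738401101376, 197539914847776, 100758192265056, 204756211603296, 204868199520096,
    199738669602336, 199738669536816, 198639426410016, 204872493438816, 100762486183776,
    204824930031456, 204893636924976, 197539914716736, 198163709761056, 198639426344496,
    204893632730976, 65582410110816, 204892547454816, 204892295796576, 204870904846176,
    204799481091936, 93158805501456, 198621727454736, 199716944115216, 83173006538256,
    100760897615376, 204870904870416, 204799481116176, 83166007293456, 100758192289296,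
    204868199544336, 204756211627536, 92059562309136, 197522484262416, 65581088929296,
    74467644700176, 65578116216336, 65582410135056, 100762486530576, 199331907315216,
    204872493785616, 204824900871696, 83174595453456, 204824930378256, 204893620282896,
    204893633077776, 204824930055696, 204893632755216, 100762486208016, 83174595130896,
    199738669606416, 204893637194256, 198639426414096, 57936544571481, 41170318737546,
    29354326573191, 61034003648676, 23380563161226, 63229269397671, 42336721260711,
    47911804760136, 42482932428951, 45430121082951, 64125541257336, 23585429864616,
    61926517993626, 42474126528651, 43583283105876, 44476166389851, 26673512345781,
    24960272003241, 46606704808011, 4959449469306, 22550545129626, 65359287980136,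
    22482362327211, 62059478163636, 44475646300266, 43446077641131, 47638017228966,
    65564691501126, 25710902816901, 64254391202181, 64056837247416, 62192572068171,
    27846001574586, 41384258519451, 61101899792811, 8467060920666, 26678106083946,
    45357190324566, 23504329806411, 11559823098201, 30376561238901, 26733558018681,
    29014450803381, 7092234179211, 58968206762631, 57520250520246, 42059139879861,
    25712543437656, 9284463403926, 78148375589001, 40984477601976, 89482229158056,
    90372092567691, 124679480713401, 55075545907371, 43230511607946, 95945646309531,
    55075545976971, 60834556125336, 24550628360361, 57335248294026, 94701683970216,
    76035468791946, 23327081537721]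
  | 13 => [
    3577438390134288, 3577438390130208, 3577438390064688, 3577438307227488, 3577438290515808,
    3577438022342208, 3577438022145888, 3577030001563488, 3576961550522208, 1630825969358688,
    3575863379826528, 3576338510714448, 3576338510583648, 3575999209412448, 3470858410006368,
    3469759166814048, 1630894420399968, 3575862307329888, 1623135293544288, 3575863379957328,
    3574140040910688, 3577412101347168, 1630827310225248, 3575239535761248, 3576962891388768,
    1342759828461408, 1349352333710688, 1349352333580128, 1623066590844768, 3454365735589728,
    1349488163166048, 1630894168741728, 3452167249205088, 3576312589784928, 1630827310421088,
    3470858257635168, 1622104501393248, 3575239535957568, 3576894205400928, 3576338292348768,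
    3577437853259328, 3576338341631568, 3574139805964128, 1340698244159328, 3454365583218528,
    3574140057622368, 3576321179588448, 3478460349749088, 3577416396248928, 3575794710550368,
    3577437787199328, 3577031610799968, 1630896029636448, 3469759282812768, 3478460618119008,
    3470858526005088, 3468659771250528, 3577416664618848, 3576338560718688, 3577438121629248,
    3460872727041888, 3576321447958368, 3452167365203808, 3577412638087008, 3575239317526368,
    3576338610001488, 1349352383715168, 3454365851588448, 3451067853641568, 3575239267391328,
    3575239569184608, 3577438055569248, 3576339064035168, 3577031627511648, 1630896046348128,
    1349489789114208, 3576339047323488, 1061353571227488, 3574831515178848, 1068013454890848,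
    3436773817980768, 1621967095994208, 3435674574788448, 1067945003849568, 3575221668026208,
    1067946076476768, 1060322779076448, 3574695198988128, 3478456054847328, 1068014795757408,
    1349351261083488, 1068012951574368, 3575217373124448, 3460863868868448, 1349487911507808,
    1340492136060768, 1068014795953248, 1067946126481248, 3443280809432928, 3436773933979488,
    3435674690787168, 1068014829180768, 3433475667662688, 1630896029897568, 3577031611061808,
    3577437853324848, 1349489772663648, 1061216165828448, 3435673885677408, 3574139772540768,
    3574899966220128, 3574695182276448, 3443275977791328, 3576338258925408, 1620936303843168,
    1060116670977888, 3469758746072928, 1067808687658848, 1630758607525728, 3443280272693088,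
    3575238780786528, 3436773397239648, 3575238830069328, 3574139537594208, 3574139520882528,
    3577437770487648, 3575238764074848, 1342691125761888, 1067808670947168, 1349283630880608,
    1621005006542688, 1339461343909728, 3575238830134848, 1349283664303968, 1630758624237408,
    3425688623454048, 3425688355084128, 3576338341762608, 3452166560094048, 3425684060182368,
    3419181748000608, 3418082504808288, 3416982993246048, 3577438121760288, 3576338610198048,
    1630896046674528, 3576321447982608, 3577412638111248, 3470858526029328, 3478460618143248,
    3576338607928848, 3436773934003728, 3469759282837008, 3576338610017808, 3478457912817168,
    3575239632123408, 3582567920072208, 3577438118508048, 3582572213990928, 3443277836744208,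
    3443282130662928, 3576338510730768, 3577438385894928, 3435674690811408, 3577416664643088,
    3575239535969808, 1068014795964768, 3575238830147088, 3577438121641488, 3454365851612688,
    3460865727821328, 3575239267538448, 3452167365228048, 1630896029905248, 3577437853333008,
    1349489772671328, 3576338341770768, 3577438390072848, 3577438121764368, 1349489789444448,
    3577438307558928, 780908614717578, 25921927533258, 981076295766678, 1551833761554588,
    1993973837775033, 1446164369813673, 586277135884473, 359692329783468, 1274561981755593,
    2293792874610873, 870281261002908, 2114524410527898, 654297338200233, 2010483672064203,
    2065025452318908, 1217740822847643, 2307262410174618, 2380654304858298]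
  | 14 => [
    62123133765838096, 62123133765817936, 62123133666530896, 62122658535773776,
    59896147489527376, 62122034423338576, 59614741232293456, 62123133497448016,
    62122033985885776, 59333266272360016, 33312213865185466, 40874642862948541,
    13902402599702731, 33378087155310811, 42001645217497261, 19466377542475981,
    20609688892317916, 32177432895934666, 41118868109570221, 28272383283142861,
    19548863642513581]
  | 15 => [
    1068984007733487120, 1068984007733483040, 1068984007733155680, 1068984007716705840,
    1068984007716444000, 1068984006107207520, 1068983938997229120, 1068983938997032800,
    1068983937656166240, 1068976246980351840, 1035199249775073120, 1068702464020387680,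
    1068702462947891040, 1068975216188200800, 1068695871515268960, 1032692363263743840,
    1070822870853621600, 1035198694113679200, 1068421125141698400, 1032410957006509920,
    1035198693692938080, 1068421056690657120, 1068420920374466400, 1070822870432880480,
    1070805278936012640, 1070805278246901600, 1030695094754744160, 1068702464020518480,
    1028470238613084000, 1030696749659330400, 1030695094065633120, 1035199793356871520,
    1068984005855549280, 1070823970096813920, 1068702599849973600, 1068702599598315360,
    1070831567741654880, 1035199793204500320, 1070823969944442720, 1068702395351111520,
    1070831572036556640, 1070813984145479520, 1068983870311044960, 1026192594639001440,
    1026193218751436640, 1023966707705190240, 1026193693882193760, 1026193693461452640,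
    1027907426098616160, 1070813975555676000, 1030697293241128800, 1035199793472870240,
    1070823970212812640, 1070813984413849440, 1068983939030456160, 1068702464070522720,
    1070831572304926560, 1030697293357127520, 1026193693998192480, 1032129482046576480,
    1068420920357754720, 1068702395317688160, 1070796387664598880, 1070796391959500640,
    1021690094102517600, 1027625951138682720, 1021690094370887520, 1026192593949890400,
    1023685301447956320, 1023122351528089440, 1070823970212836880, 1070813984413873680,
    1070813977414628880, 1068702464020534800, 1070831572304950800, 1070831569599624720,
    1070831573893543440, 1030697293357151760, 735327336965980395, 752545900512661710,
    659061178992672990, 312778186975789245, 730574242338033870, 333591361419653340,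
    222691119129813180, 441783310924697790, 164547641926930620, 226949200709738715,
    236343486495772875, 406029054997487835, 762537943305728205, 246372599273640060,
    103104307816796280, 193159391011705035, 343740882180026535, 340064254950281340,
    168681239627092170, 181637953350979770, 353316871251333210, 273363486124896645,
    281516143322898795, 269449968749404830]
  | _ => []

/-- Base-16 encoded copies of the patterns in `family n` met during the searches below. -/
def copyDigits : ℕ → List (List ℕ)
  | 5 => [[16, 33]]
  | 6 =>
    [[1347, 784, 1296, 1332, 1040, 528, 804, 1025, 513, 1059, 769, 1281, 1316, 1061, 1077, 805,
    1346, 1330, 1074, 1315, 801, 786, 770, 531]]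
  | 7 =>
    [[25104, 21008, 16912, 12816, 25601, 25857, 25345, 17153, 21505, 21506, 17154, 25602, 21249,
    21250, 25346, 25858, 17168, 16897, 12801, 17170, 16915, 8451, 12820, 8452, 16899, 12804,
    12546, 16642, 17184, 16643, 17185, 12548], [9744, 9232, 8976, 9488, 12816, 16912, 17168,
    13328, 12576, 13344, 13345, 17185, 16945], [528, 784, 1040, 1074, 800, 1056, 1073, 1072,
    1057, 801]]
  | 8 =>
    [[784, 528, 800, 1347, 1040, 1296, 1056, 1312, 1346, 801, 1057, 1313, 1073, 1329, 1072,
    1328, 1344, 1074, 1345, 1330], [274960, 406032, 340496, 471568, 344592, 344833, 344595,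
    340500, 274965, 344848, 344577, 344850, 340481, 274945, 344864, 344865, 344323, 344322,
    340226, 340228, 274690, 270597, 270595, 336131, 336132, 274693, 205060, 205061]]
  | 9 =>
    [[8241, 8257, 4146, 4162, 4194, 8289, 8512, 8544, 4210, 8560, 8305, 8273, 8528, 8321, 8576,
    4178, 4226, 8496, 8259, 12321, 12354, 16434, 16417, 12353, 16433, 4163, 12576], [7614992,
    5517840, 8663568, 6566416, 6631952, 8794640, 7746064, 7680528, 8729104, 8860176, 8798736,
    7750160, 6636048, 7754256, 8802832, 8872464, 6566401, 7614977, 5517825, 8663553, 8794625,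
    7746049, 6631937, 8729089, 7680513, 8860161, 7750145, 6636033, 8798721, 8872449, 7754241,
    8802817, 8733185, 7684609, 8864257, 8868353, 7614722, 5517570, 6566146, 8663298, 7749890,
    7684354, 8864002, 6635778, 8732930, 8798466, 8859906, 8872194, 8868098, 7745794, 7753986,
    7680258, 6631682, 8728834, 8802562, 8794370, 7684624, 8733200, 8868368, 8864272], [274960,
    406032, 471568, 340496, 537104, 410128, 414224, 549392, 483856, 406017, 405762, 274945,
    340481, 471553, 537089, 549377, 410113, 483841, 414209, 409858, 344577, 475649, 541185,
    553473, 479745, 475664, 475394, 274690, 344322, 540930, 479490, 553218, 483586, 471298,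
    479760, 413954, 340226, 545026, 549122, 536834, 545281, 545296, 344592, 541200, 553488,
    205840, 271120]]
  | 10 =>
    [[12816, 17185, 16912, 17184, 17168], [122958352, 106181136, 139735568, 156512784], [266290,
    331826, 397362, 462898, 528434, 593970, 274465, 274720, 270385, 204865, 274960, 270640,
    205120, 200770, 135235]]
  | 11 =>
    [[12816, 17168, 16912, 17185, 21281, 21537, 21553, 21520, 21264, 21008, 21552, 21536, 21554,
    17184, 21280], [2522100240, 2253664784, 2790535696, 1985229328]]
  | 12 =>
    [[204897, 135267, 200802, 135283, 200818, 204913, 205152, 205168, 135299, 200834, 205184,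
    135315, 205200, 200850, 204929, 204945, 204865, 205120, 135235, 204961, 205216, 135331,
    200770, 200866, 204881, 205136, 200786, 204977, 205232, 200882, 135251, 135347, 335921,
    340001, 204884, 270419, 335939, 274514, 340034, 344114, 270640, 270417, 274720, 200788,
    266323, 344352, 331843, 340256, 205140, 270675, 336195, 274770, 340290, 344370, 344865,
    344848, 340545, 275025, 344864], [40639934992, 36344967696, 49229869584, 44934902288]]
  | 13 => [[654820258320, 792259211792, 860978688528, 723539735056], [274960]]
  | 14 =>
    [[14948471419408, 12749448163856, 13848959791632, 11649936536080], [274960, 344848, 344864,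
    344865]]
  | 15 => [[257940541157904, 222756169069072, 240348355113488, 205163983024656]]
  | _ => []

/-- The copies listed in `copyDigits`, paired with their patterns. -/
def copies (n : ℕ) : List (Pattern × ℕ) :=
  ((family n).zip (copyDigits n)).flatMap fun t => t.2.map fun a => (t.1, a)

/-- All searches needed to pass from `n - 1` to `n` vertices. -/
def stepCheck (n : ℕ) : Bool :=
  (hints n).all (isArrangement n) &&
  (copies (n - 1)).all (fun t => isCopy n t.1 t.2) &&
  (copies n).all (fun t => isCopy n t.1 t.2) &&
  (family (n - 1)).all (fun P => run n n P.2 (hints n) (copies n)) &&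
  run n (2 * (n - 3) / ((n - 2) / 4 + 1)) [] (hints n) (copies (n - 1))

set_option maxHeartbeats 0 in
theorem stepCheck_eq_true {n : ℕ} (h6 : 6 ≤ n) (h15 : n ≤ 15) : stepCheck n = true := by
  interval_cases n <;> decide +kernel

/-! ### Soundness of the search -/

theorem pairCode_eq (u v : ℕ) : pairCode u v = 16 * min u v + max u v := by
  unfold pairCode
  cases h : Nat.ble u v with
  | true =>
    have := Nat.le_of_ble_eq_true h
    rw [cond_true]
    lia
  | false =>
    have : ¬ u ≤ v := fun h' => by simp [Nat.ble_eq_true_of_le h'] at h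
    rw [cond_false]
    lia

theorem pairCode_comm (u v : ℕ) : pairCode u v = pairCode v u := by
  rw [pairCode_eq, pairCode_eq, min_comm, max_comm]

theorem pairCode_inj {u v x y : ℕ} (hu : u < 16) (hv : v < 16) (hx : x < 16) (hy : y < 16)
    (h : pairCode u v = pairCode x y) : u = x ∧ v = y ∨ u = y ∧ v = x := by
  rw [pairCode_eq, pairCode_eq] at h
  omega

theorem testBit_toMask (l : List ℕ) (c : ℕ) : (toMask l).testBit c = true ↔ c ∈ l := by
  induction l with
  | nil => simp [toMask]
  | cons d ds ih =>
    simp only [toMask, Nat.testBit_or, Bool.or_eq_true, ih, List.mem_cons, Nat.one_shiftLeft,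
      Nat.testBit_two_pow, decide_eq_true_eq]
    tauto

theorem beq_land_one (N c : ℕ) :
    Nat.beq (Nat.land (Nat.shiftRight N c) 1) 1 = N.testBit c := by
  have h : Nat.land (Nat.shiftRight N c) 1 = (N >>> c) % 2 := Nat.and_one_is_mod _
  rw [h, Nat.testBit_eq_decide_div_mod_eq, Nat.shiftRight_eq_div_pow, Bool.eq_iff_iff,
    Nat.beq_eq, decide_eq_true_eq]

theorem testBit_insert (E c d : ℕ) :
    (Nat.lor E (Nat.shiftLeft 1 c)).testBit d = true ↔ d = c ∨ E.testBit d = true := by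
  have h : Nat.lor E (Nat.shiftLeft 1 c) = E ||| 1 <<< c := rfl
  simp only [h, Nat.testBit_or, Bool.or_eq_true, Nat.one_shiftLeft, Nat.testBit_two_pow,
    decide_eq_true_eq]
  tauto

/-- The set of codes of the edges of `F`. -/
def edgeCodes {n : ℕ} (F : SimpleGraph (Fin n)) : Set ℕ :=
  {c | ∃ u v : Fin n, F.Adj u v ∧ pairCode u v = c}

theorem edgeCodes_eq_image {n : ℕ} (F : SimpleGraph (Fin n)) :
    edgeCodes F = Sym2.lift ⟨fun u v : Fin n => pairCode u v, fun u v => pairCode_comm u v⟩ ''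
      F.edgeSet := by
  ext c
  constructor
  · rintro ⟨u, v, h, rfl⟩
    exact ⟨s(u, v), h, rfl⟩
  · rintro ⟨e, he, rfl⟩
    induction e with | _ u v => exact ⟨u, v, he, rfl⟩

theorem finite_edgeCodes {n : ℕ} (F : SimpleGraph (Fin n)) : (edgeCodes F).Finite := by
  rw [edgeCodes_eq_image]
  exact (Set.toFinite _).image _

theorem ncard_edgeCodes_le {n : ℕ} (F : SimpleGraph (Fin n)) :
    (edgeCodes F).ncard ≤ F.edgeSet.ncard := by
  rw [edgeCodes_eq_image]
  exact Set.ncard_image_le (Set.toFinite _)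

theorem pairCode_mem_edgeCodes {n : ℕ} (hn : n ≤ 16) {F : SimpleGraph (Fin n)} {u v : Fin n} :
    pairCode u v ∈ edgeCodes F ↔ F.Adj u v := by
  refine ⟨?_, fun h => ⟨u, v, h, rfl⟩⟩
  rintro ⟨x, y, hxy, he⟩
  rcases pairCode_inj (by lia) (by lia) (by lia) (by lia) he with ⟨h₁, h₂⟩ | ⟨h₁, h₂⟩
  · rwa [← Fin.ext h₁, ← Fin.ext h₂]
  · rw [← Fin.ext h₁, ← Fin.ext h₂]
    exact hxy.symm

theorem branch_sound {C : Set ℕ} {goal : Prop} {go : ℕ → ℕ → Bool} {E : ℕ} :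
    ∀ (l : List ℕ) (N : ℕ), branch go E l N = true → (∀ c, N.testBit c = true → c ∉ C) →
      (∀ c ∈ l, c ∈ C → ∀ M : ℕ, (∀ d, M.testBit d = true → d ∉ C) →
        go (Nat.lor E (Nat.shiftLeft 1 c)) M = true → goal) →
      ((∀ c ∈ l, c ∉ C) → goal) → goal
  | [], _, _, _, _, h => h (by simp)
  | c :: cs, N, hb, hN, hgo, h => by
    rw [branch, beq_land_one] at hb
    cases hc : N.testBit c with
    | true =>
      rw [hc, cond_true] at hb
      refine branch_sound cs N hb hN (fun d hd => hgo d (List.mem_cons_of_mem _ hd)) fun h' =>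
        h fun d hd => ?_
      rcases List.mem_cons.1 hd with rfl | hd
      exacts [hN _ hc, h' d hd]
    | false =>
      rw [hc, cond_false, Bool.and_eq_true] at hb
      by_cases hcC : c ∈ C
      · exact hgo c List.mem_cons_self hcC N hN hb.1
      · refine branch_sound cs _ hb.2 (fun d hd => ?_)
          (fun d hd => hgo d (List.mem_cons_of_mem _ hd)) fun h' => h fun d hd => ?_
        · rcases (testBit_insert _ _ _).1 hd with rfl | hd
          exacts [hcC, hN d hd]
        · rcases List.mem_cons.1 hd with rfl | hd
          exacts [hcC, h' d hd]

theorem search_sound {C : Set ℕ} (hC : C.Finite) {goal : Prop} {leaf : ℕ → Bool}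
    (hleaf : ∀ E, leaf E = true → (∀ c, E.testBit c = true → c ∈ C) → goal) :
    ∀ (r : ℕ) (table : List (ℕ × List ℕ)) (E N : ℕ) (S : Finset ℕ),
      search leaf r table E N = true →
      (∀ t ∈ table, t.1 = toMask t.2 ∧ ((∀ c ∈ t.2, c ∉ C) → goal)) →
      (∀ c, E.testBit c = true ↔ c ∈ S) → (↑S : Set ℕ) ⊆ C → C.ncard ≤ S.card + r →
      (∀ c, N.testBit c = true → c ∉ C) → goal
  | 0, table, E, N, S, hs, ht, hE, hS, hcard, hN => by
    rw [search] at hs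
    split at hs
    · exact hleaf E hs fun c hc => hS ((hE c).1 hc)
    · rename_i t ts heq
      have hmem : t ∈ table.filter fun t => Nat.beq (Nat.land t.1 E) 0 := by
        rw [heq]
        exact List.mem_cons_self
      rw [List.mem_filter] at hmem
      have hz : t.1 &&& E = 0 := Nat.eq_of_beq_eq_true hmem.2
      have hCS : (↑S : Set ℕ) = C :=
        Set.eq_of_subset_of_ncard_le hS (by rw [Set.ncard_coe_finset]; lia) hC
      refine (ht t hmem.1).2 fun c hc hcC => ?_
      have h₁ : t.1.testBit c = true := by rw [(ht t hmem.1).1, testBit_toMask]; exact hc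
      have h₂ : E.testBit c = true := (hE c).2 (by rw [← hCS] at hcC; exact hcC)
      have h₃ := Nat.testBit_and t.1 E c
      rw [hz, h₁, h₂] at h₃
      simp at h₃
  | r + 1, table, E, N, S, hs, ht, hE, hS, hcard, hN => by
    rw [search] at hs
    split at hs
    · exact hleaf E hs fun c hc => hS ((hE c).1 hc)
    · rename_i t ts heq
      have hsub : ∀ u ∈ t :: ts, u ∈ table ∧ u.1 &&& E = 0 := by
        intro u hu
        rw [← heq, List.mem_filter] at hu
        exact ⟨hu.1, Nat.eq_of_beq_eq_true hu.2⟩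
      have ht₀ := hsub t List.mem_cons_self
      refine branch_sound t.2 N hs hN (fun c hc hcC M hM hgo => ?_) (ht t ht₀.1).2
      have hcS : c ∉ S := fun hcS => by
        have h₁ : t.1.testBit c = true := by rw [(ht t ht₀.1).1, testBit_toMask]; exact hc
        have h₃ := Nat.testBit_and t.1 E c
        rw [ht₀.2, h₁, (hE c).2 hcS] at h₃
        simp at h₃
      refine search_sound hC hleaf r (t :: ts) _ M (insert c S) hgo
        (fun u hu => ht u (hsub u hu).1) (fun d => ?_) ?_ ?_ hM
      · rw [testBit_insert, Finset.mem_insert, hE]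
      · rw [Finset.coe_insert]
        exact Set.insert_subset hcC hS
      · rw [Finset.card_insert_of_notMem hcS]
        lia

theorem nodup_map_range_inj {m : ℕ} {g : ℕ → ℕ} (h : ((List.range m).map g).Nodup) {i j : ℕ}
    (hi : i < m) (hj : j < m) (hij : g i = g j) : i = j :=
  List.inj_on_of_nodup_map h (List.mem_range.2 hi) (List.mem_range.2 hj) hij

theorem isPackable_of_isArrangement {n a : ℕ} (h0 : 0 < n) (hn : n ≤ 16) {F : SimpleGraph (Fin n)}
    (ha : isArrangement n a = true) (hF : ∀ c ∈ closePairs n a, c ∉ edgeCodes F) :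
    IsPackable F := by
  simp only [isArrangement, Bool.and_eq_true, List.all_eq_true, List.mem_range,
    decide_eq_true_eq] at ha
  obtain ⟨hlt, hnd⟩ := ha
  have hlt' : ∀ i, i < n → vertexAt a i < n := fun i hi => by
    simpa [Nat.blt_eq] using hlt i hi
  refine ⟨fun i => ⟨vertexAt a (i % n), hlt' _ (Nat.mod_lt _ h0)⟩, fun i => by simp, ?_, ?_⟩
  · intro i hi j hj hij
    simp only [Set.mem_ofPred_eq] at hi hj
    simp only [Fin.mk.injEq, Nat.mod_eq_of_lt hi, Nat.mod_eq_of_lt hj] at hij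
    exact nodup_map_range_inj hnd hi hj hij
  · intro i
    have key : ∀ d, d = 1 ∨ d = 2 →
        pairCode (vertexAt a (i % n)) (vertexAt a ((i + d) % n)) ∉ edgeCodes F := by
      intro d hd
      apply hF
      rw [closePairs, List.mem_flatMap]
      refine ⟨i % n, List.mem_range.2 (Nat.mod_lt _ h0), ?_⟩
      rcases hd with rfl | rfl <;> simp
    exact ⟨fun h => key 1 (.inl rfl) ((pairCode_mem_edgeCodes hn).2 h),
      fun h => key 2 (.inr rfl) ((pairCode_mem_edgeCodes hn).2 h)⟩

theorem hasPattern_of_isCopy {n a : ℕ} (hn : n ≤ 16) {F : SimpleGraph (Fin n)} {P : Pattern}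
    (ha : isCopy n P a = true)
    (hF : ∀ c, (copyMask P a).testBit c = true → c ∈ edgeCodes F) : HasPattern F P := by
  simp only [isCopy, Bool.and_eq_true, List.all_eq_true, List.mem_range,
    decide_eq_true_eq, Nat.blt_eq] at ha
  obtain ⟨⟨hlt, hnd⟩, hes⟩ := ha
  refine ⟨fun i => ⟨vertexAt a i, hlt i i.2⟩, fun i j hij => ?_, fun e he => ?_⟩
  · rw [Fin.mk.injEq] at hij
    exact Fin.ext (nodup_map_range_inj hnd i.2 j.2 hij)
  · refine ⟨⟨e.1, (hes e he).1⟩, ⟨e.2, (hes e he).2⟩, rfl, rfl, ?_⟩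
    rw [← pairCode_mem_edgeCodes hn]
    apply hF
    rw [copyMask, testBit_toMask]
    exact List.mem_map.2 ⟨e, he, rfl⟩

theorem run_sound {n s : ℕ} (h0 : 0 < n) (hn : n ≤ 16) {F : SimpleGraph (Fin n)}
    (hcard : F.edgeSet.ncard ≤ n - 3) {es : List (ℕ × ℕ)} {arrs : List ℕ}
    {cps : List (Pattern × ℕ)} (hrun : run n s es arrs cps = true)
    (harrs : ∀ a ∈ arrs, isArrangement n a = true)
    (hcps : ∀ t ∈ cps, isCopy n t.1 t.2 = true)
    (hes : ∀ e ∈ es, ∃ a b : Fin n, (a : ℕ) = e.1 ∧ (b : ℕ) = e.2 ∧ F.Adj a b)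
    (hs : ∀ u v, F.Adj u v → (u : ℕ) < s) :
    IsPackable F ∨ ∃ t ∈ cps, HasPattern F t.1 := by
  refine search_sound (finite_edgeCodes F) ?_ _ _ _ _
    (es.map fun e => pairCode e.1 e.2).toFinset hrun ?_ ?_ ?_ ?_ ?_
  · intro E hE hEF
    rw [List.any_map, List.any_eq_true] at hE
    obtain ⟨t, ht, hM⟩ := hE
    refine .inr ⟨t, ht, hasPattern_of_isCopy hn (hcps t ht) fun c hc => hEF c ?_⟩
    have hM' : copyMask t.1 t.2 &&& E = copyMask t.1 t.2 := Nat.eq_of_beq_eq_true hM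
    rw [← hM', Nat.testBit_and, Bool.and_eq_true] at hc
    exact hc.2
  · intro t ht
    obtain ⟨a, ha, rfl⟩ := List.mem_map.1 ht
    exact ⟨rfl, fun h => .inl (isPackable_of_isArrangement h0 hn (harrs a ha) h)⟩
  · intro c
    rw [testBit_toMask, List.mem_toFinset]
  · intro c hc
    obtain ⟨e, he, rfl⟩ := List.mem_map.1 (List.mem_toFinset.1 hc)
    obtain ⟨a, b, ha, hb, hab⟩ := hes e he
    exact ⟨a, b, hab, by simp only [ha, hb]⟩
  · rw [List.card_toFinset]
    have := ncard_edgeCodes_le F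
    lia
  · rintro c hc ⟨u, v, huv, rfl⟩
    rw [testBit_toMask, List.mem_filter] at hc
    have h₁ := Nat.le_of_ble_eq_true hc.2
    have h₂ := hs u v huv
    have h₃ := hs v u huv.symm
    rw [pairCode_eq] at h₁
    lia

/-! ### Relabelling -/

theorem exists_perm_extending {m n : ℕ} (f : Fin m → Fin n) (hf : Function.Injective f) :
    ∃ σ : Equiv.Perm (Fin n), ∀ (i : Fin m) (x : Fin n), (x : ℕ) = i → σ x = f i := by
  classical
  have hmn : m ≤ n := by simpa using Fintype.card_le_of_injective f hf
  let e : {x // x ∈ Set.range (Fin.castLE hmn)} ≃ {x // x ∈ Set.range f} :=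
    (Equiv.ofInjective _ (Fin.castLE_injective hmn)).symm.trans (Equiv.ofInjective f hf)
  refine ⟨e.extendSubtype, fun i x hx => ?_⟩
  obtain rfl : x = Fin.castLE hmn i := Fin.ext hx
  rw [Equiv.extendSubtype_apply_of_mem e _ ⟨i, rfl⟩]
  simp only [e, Equiv.trans_apply]
  have : (Equiv.ofInjective _ (Fin.castLE_injective hmn)).symm
      ⟨Fin.castLE hmn i, i, rfl⟩ = i := by
    rw [Equiv.symm_apply_eq]
    rfl
  rw [this]
  rfl

theorem IsPackable.of_comap {n : ℕ} {F : SimpleGraph (Fin n)} {σ : Equiv.Perm (Fin n)}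
    (h : IsPackable (F.comap σ)) : IsPackable F := by
  obtain ⟨p, hp, hinj, hadj⟩ := h
  exact ⟨fun i => σ (p i), fun i => congrArg σ (hp i), fun i hi j hj hij =>
    hinj hi hj (σ.injective hij), hadj⟩

theorem HasPattern.of_comap {m n : ℕ} {F : SimpleGraph (Fin n)} {g : Fin m → Fin n}
    (hg : Function.Injective g) {P : Pattern} (h : HasPattern (F.comap g) P) :
    HasPattern F P := by
  obtain ⟨f, hf, hes⟩ := h
  exact ⟨g ∘ f, hg.comp hf, hes⟩

theorem ncard_edgeSet_comap_le {m n : ℕ} (F : SimpleGraph (Fin n)) {g : Fin m → Fin n}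
    (hg : Function.Injective g) : (F.comap g).edgeSet.ncard ≤ F.edgeSet.ncard := by
  rw [← Set.ncard_image_of_injective _ (Sym2.map.injective hg)]
  refine Set.ncard_le_ncard ?_ (Set.toFinite _)
  rintro _ ⟨e, he, rfl⟩
  induction e with | _ u v => exact he

/-! ### Removing a vertex of small degree -/

theorem ncard_edgeSet_comap_succAbove_lt {n : ℕ} (F : SimpleGraph (Fin (n + 1)))
    {v w : Fin (n + 1)} (hvw : F.Adj v w) :
    (F.comap v.succAbove).edgeSet.ncard < F.edgeSet.ncard := by
  rw [← Set.ncard_image_of_injective _ (Sym2.map.injective v.succAbove_right_injective)]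
  refine Set.ncard_lt_ncard (Set.ssubset_iff_of_subset ?_ |>.2 ⟨s(v, w), hvw, ?_⟩) (Set.toFinite _)
  · rintro _ ⟨e, he, rfl⟩
    induction e with | _ x y => exact he
  · rintro ⟨e, -, he⟩
    induction e with
    | _ x y =>
      rw [Sym2.map_mk, Sym2.eq_iff] at he
      rcases he with ⟨h, -⟩ | ⟨-, h⟩ <;> exact v.succAbove_ne _ h

theorem exists_gap {n : ℕ} (h0 : 0 < n) {p : ℕ → Fin n} (hp : Function.Periodic p n)
    (hinj : Set.InjOn p {i | i < n}) (A : Finset (Fin n)) (hA : 4 * A.card < n) :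
    ∃ k, ∀ j < 4, p (k + j) ∉ A := by
  classical
  by_contra! h
  have hsub : Finset.range n ⊆ (Finset.range 4).biUnion fun j =>
      (Finset.range n).filter fun k => p (k + j) ∈ A := by
    intro k hk
    obtain ⟨j, hj, hjA⟩ := h k
    simp only [Finset.mem_biUnion, Finset.mem_filter]
    exact ⟨j, Finset.mem_range.2 hj, hk, hjA⟩
  have hle : ∀ j ∈ Finset.range 4, ((Finset.range n).filter fun k => p (k + j) ∈ A).card ≤
      A.card := by
    intro j _
    refine Finset.card_le_card_of_injOn (fun k => p (k + j))
      (fun k hk => (Finset.mem_filter.1 hk).2) fun k hk l hl hkl => ?_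
    simp only [Finset.coe_filter, Finset.mem_range, Set.mem_ofPred_eq] at hk hl
    simp only at hkl
    rw [← hp.map_mod_nat (k + j), ← hp.map_mod_nat (l + j)] at hkl
    have := hinj (Nat.mod_lt _ h0) (Nat.mod_lt _ h0) hkl
    have hmod : k ≡ l [MOD n] := Nat.ModEq.add_right_cancel' j this
    exact Nat.ModEq.eq_of_lt_of_lt hmod hk.1 hl.1
  have h₁ := Finset.card_le_card hsub
  have h₂ := Finset.card_biUnion_le_card_mul (Finset.range 4)
    (fun j => (Finset.range n).filter fun k => p (k + j) ∈ A) A.card hle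
  simp only [Finset.card_range] at h₁ h₂
  lia

theorem IsPackable.insert {n : ℕ} (h3 : 3 ≤ n) {F : SimpleGraph (Fin (n + 1))} {v : Fin (n + 1)}
    (h : IsPackable (F.comap v.succAbove)) [Fintype (F.neighborSet v)]
    (hdeg : 4 * F.degree v < n) : IsPackable F := by
  classical
  obtain ⟨p, hp, hinj, hadj⟩ := h
  obtain ⟨k, hk⟩ := exists_gap (by lia) hp hinj
    (Finset.univ.filter fun x => F.Adj v (v.succAbove x)) (by
      refine lt_of_le_of_lt (Nat.mul_le_mul_left 4 ?_) hdeg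
      rw [← F.card_neighborFinset_eq_degree]
      refine Finset.card_le_card_of_injOn v.succAbove (fun x hx => ?_)
        v.succAbove_right_injective.injOn
      simpa using hx)
  replace hk : ∀ j < 4, ¬ F.Adj v (v.succAbove (p (k + j))) := by simpa using hk
  let q : ℕ → Fin (n + 1) := fun i => if i = n then v else v.succAbove (p (k + 2 + i))
  have hq : ∀ i, i ≠ n → q i = v.succAbove (p (k + 2 + i)) := fun i hi => if_neg hi
  have hqn : q n = v := if_pos rfl
  have hper : ∀ i, p (k + 2 + (n + i)) = p (k + 2 + i) := fun i => by
    rw [← hp (k + 2 + i)]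
    congr 1
    lia
  refine ⟨fun i => q (i % (n + 1)), fun i => by simp, fun i hi j hj hij => ?_, fun i => ?_⟩
  · simp only [Set.mem_ofPred_eq] at hi hj
    simp only [Nat.mod_eq_of_lt hi, Nat.mod_eq_of_lt hj] at hij
    by_cases hin : i = n <;> by_cases hjn : j = n
    · rw [hin, hjn]
    · rw [hin, hqn, hq j hjn] at hij
      exact absurd hij.symm (v.succAbove_ne _)
    · rw [hjn, hqn, hq i hin] at hij
      exact absurd hij (v.succAbove_ne _)
    · rw [hq i hin, hq j hjn] at hij
      have h' := v.succAbove_right_injective hij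
      rw [← hp.map_mod_nat (k + 2 + i), ← hp.map_mod_nat (k + 2 + j)] at h'
      have := hinj (Nat.mod_lt _ (by lia)) (Nat.mod_lt _ (by lia)) h'
      have hmod : i ≡ j [MOD n] := Nat.ModEq.add_left_cancel' (k + 2) this
      exact Nat.ModEq.eq_of_lt_of_lt hmod (by lia) (by lia)
  · have hpair : ∀ i d, d = 1 ∨ d = 2 →
        ¬ F.Adj (v.succAbove (p i)) (v.succAbove (p (i + d))) := by
      rintro i d (rfl | rfl)
      exacts [(hadj i).1, (hadj i).2]
    have key : ∀ r d, r < n + 1 → d = 1 ∨ d = 2 → ¬ F.Adj (q r) (q ((r + d) % (n + 1))) := by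
      intro r d hr hd
      by_cases hrn : r = n
      · have hmod : (r + d) % (n + 1) = d - 1 := by
          rw [Nat.mod_eq_sub_mod (by lia), Nat.mod_eq_of_lt (by lia)]
          lia
        rw [hmod, hrn, hqn, hq _ (by lia)]
        have := hk (d + 1) (by lia)
        rwa [show k + (d + 1) = k + 2 + (d - 1) by lia] at this
      · rw [hq r hrn]
        by_cases hwrap : r + d < n + 1
        · rw [Nat.mod_eq_of_lt hwrap]
          by_cases hrd : r + d = n
          · rw [hrd, hqn]
            have := hk (2 - d) (by lia)
            rw [← hp, show k + (2 - d) + n = k + 2 + r by lia] at this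
            exact fun h => this h.symm
          · rw [hq _ hrd, ← add_assoc]
            exact hpair (k + 2 + r) d hd
        · have hmod : (r + d) % (n + 1) = 0 := by
            rw [Nat.mod_eq_sub_mod (by lia), Nat.mod_eq_of_lt (by lia)]
            lia
          rw [hmod, hq 0 (by lia)]
          have := hpair (k + 2 + r) 1 (.inl rfl)
          rw [show k + 2 + r + 1 = k + 2 + (n + 0) by lia, hper 0] at this
          exact this
    have hstep : ∀ d, (i + d) % (n + 1) = (i % (n + 1) + d) % (n + 1) := fun d => by simp
    simp only [hstep]
    exact ⟨key _ 1 (Nat.mod_lt _ (by lia)) (.inl rfl), key _ 2 (Nat.mod_lt _ (by lia)) (.inr rfl)⟩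

/-! ### The induction -/

theorem mem_family_of_mem_copies {n : ℕ} {t : Pattern × ℕ} (h : t ∈ copies n) :
    t.1 ∈ family n := by
  rw [copies, List.mem_flatMap] at h
  obtain ⟨s, hs, ht⟩ := h
  obtain ⟨a, -, rfl⟩ := List.mem_map.1 ht
  exact (List.of_mem_zip hs).1

theorem card_support_mul_le {n d : ℕ} (F : SimpleGraph (Fin n)) [DecidableRel F.Adj]
    (hd : ∀ v, F.degree v ≠ 0 → d ≤ F.degree v) :
    (Finset.univ.filter fun v => F.degree v ≠ 0).card * d ≤ 2 * F.edgeSet.ncard := by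
  rw [Set.ncard_eq_toFinset_card', ← SimpleGraph.edgeFinset, ← F.sum_degrees_eq_twice_card_edges]
  calc _ ≤ ∑ v ∈ Finset.univ.filter (fun v => F.degree v ≠ 0), F.degree v :=
        Finset.card_nsmul_le_sum _ _ _ fun v hv => hd v (Finset.mem_filter.1 hv).2
    _ ≤ _ := Finset.sum_le_sum_of_subset (Finset.filter_subset _ _)

theorem isPackable_of_forall_not_adj {n : ℕ} (h0 : 0 < n) {F : SimpleGraph (Fin n)}
    (hF : ∀ u v, ¬ F.Adj u v) : IsPackable F := by
  refine ⟨fun i => ⟨i % n, Nat.mod_lt _ h0⟩, fun i => by simp, fun i hi j hj hij => ?_,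
    fun i => ⟨hF _ _, hF _ _⟩⟩
  simpa [Nat.mod_eq_of_lt (Set.mem_ofPred.1 hi), Nat.mod_eq_of_lt (Set.mem_ofPred.1 hj)] using hij

theorem isPackable_or_hasPattern {n : ℕ} (h5 : 5 ≤ n) (h15 : n ≤ 15) (F : SimpleGraph (Fin n))
    (hF : F.edgeSet.ncard ≤ n - 3) : IsPackable F ∨ ∃ P ∈ family n, HasPattern F P := by
  classical
  induction n, h5 using Nat.le_induction with
  | base =>
    by_cases h : ∃ u v, F.Adj u v
    · obtain ⟨u, v, huv⟩ := h
      refine .inr ⟨_, List.mem_singleton.2 rfl, ![u, v], ?_, fun e he => ?_⟩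
      · intro i j hij
        fin_cases i <;> fin_cases j <;> simp_all [huv.ne, huv.ne']
      · rw [List.mem_singleton] at he
        subst he
        exact ⟨0, 1, rfl, rfl, huv⟩
    · push Not at h
      exact .inl (isPackable_of_forall_not_adj (by lia) h)
  | succ n h5 ih =>
    have hcheck := stepCheck_eq_true (n := n + 1) (by lia) h15
    simp only [stepCheck, Bool.and_eq_true, List.all_eq_true, Nat.add_sub_cancel] at hcheck
    obtain ⟨⟨⟨⟨harrs, hcps⟩, hcps'⟩, hfam⟩, hsupp⟩ := hcheck
    by_cases hP : ∃ P ∈ family n, HasPattern F P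
    · obtain ⟨P, hPn, f, hf, hes⟩ := hP
      obtain ⟨σ, hσ⟩ := exists_perm_extending f hf
      have hPn' : P.1 ≤ n + 1 := by simpa using Fintype.card_le_of_injective f hf
      rcases run_sound (F := F.comap σ) (by lia) (by lia)
        ((ncard_edgeSet_comap_le F σ.injective).trans hF) (hfam P hPn) harrs hcps'
        (fun e he => by
          obtain ⟨a, b, ha, hb, hab⟩ := hes e he
          refine ⟨Fin.castLE hPn' a, Fin.castLE hPn' b, ha, hb, ?_⟩
          rw [SimpleGraph.comap_adj, hσ a _ rfl, hσ b _ rfl]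
          exact hab)
        (fun u _ _ => u.2) with h | ⟨t, ht, h⟩
      · exact .inl h.of_comap
      · exact .inr ⟨t.1, mem_family_of_mem_copies ht, h.of_comap σ.injective⟩
    by_cases hv : ∃ v, F.degree v ≠ 0 ∧ 4 * F.degree v < n
    · obtain ⟨v, hv0, hvn⟩ := hv
      obtain ⟨w, hvw⟩ := (F.degree_pos_iff_exists_adj v).1 (Nat.pos_of_ne_zero hv0)
      have hlt := ncard_edgeSet_comap_succAbove_lt F hvw
      rcases ih (by lia) (F.comap v.succAbove) (by lia) with h | ⟨P, hPn, h⟩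
      · exact .inl (h.insert (by lia) hvn)
      · exact absurd ⟨P, hPn, h.of_comap v.succAbove_right_injective⟩ hP
    · push Not at hv
      set d := (n + 1 - 2) / 4 + 1 with hd
      set s := 2 * (n + 1 - 3) / d with hs
      set U := Finset.univ.filter fun v => F.degree v ≠ 0 with hU
      have hUs : U.card ≤ s := by
        rw [hs, Nat.le_div_iff_mul_le (by lia)]
        refine (card_support_mul_le F fun v hv' => ?_).trans (Nat.mul_le_mul_left 2 hF)
        have := hv v hv'
        lia
      obtain ⟨σ, hσ⟩ := exists_perm_extending (fun i => (U.equivFin.symm i : Fin (n + 1)))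
        (Subtype.val_injective.comp U.equivFin.symm.injective)
      have hUn : U.card ≤ n + 1 := by simpa using Finset.card_le_univ U
      rcases run_sound (F := F.comap σ) (by lia) (by lia)
        ((ncard_edgeSet_comap_le F σ.injective).trans hF) hsupp harrs hcps (by simp)
        (fun u v huv => by
          have hmem : σ u ∈ U := by
            rw [hU, Finset.mem_filter]
            exact ⟨Finset.mem_univ _,
              ((F.degree_pos_iff_exists_adj _).2 ⟨σ v, huv⟩).ne'⟩
          have h := hσ (U.equivFin ⟨σ u, hmem⟩) (Fin.castLE hUn (U.equivFin ⟨σ u, hmem⟩)) rfl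
          rw [Equiv.symm_apply_apply, σ.injective.eq_iff] at h
          rw [← h]
          exact lt_of_lt_of_le (U.equivFin ⟨σ u, hmem⟩).2 hUs) with h | ⟨t, ht, h⟩
      · exact .inl h.of_comap
      · exact absurd ⟨t.1, mem_family_of_mem_copies ht, h.of_comap σ.injective⟩ hP

/-! ### Translation to containment -/

theorem IsPackable.contains {n : ℕ} {F : SimpleGraph (Fin n)} (h : IsPackable F) :
    Contains (cycleSq n)ᶜ F := by
  obtain ⟨p, hp, hinj, hadj⟩ := h
  have hbij : Function.Bijective fun i : Fin n => p i :=
    Finite.injective_iff_bijective.1 fun i j hij => Fin.ext (hinj i.2 j.2 hij)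
  let e := Equiv.ofBijective _ hbij
  have he : ∀ a, p (e.symm a : ℕ) = a := fun a => e.apply_symm_apply a
  have hclose : ∀ a b, ∀ d : ℕ, ((e.symm b : ℕ) : ZMod n) - ((e.symm a : ℕ) : ZMod n) = (d : ℕ) →
      b = p ((e.symm a : ℕ) + d) := by
    intro a b d h
    rw [sub_eq_iff_eq_add', ← Nat.cast_add, ZMod.natCast_eq_natCast_iff'] at h
    rw [← he b, ← hp.map_mod_nat, h, hp.map_mod_nat]
  have hnot : ∀ a b, F.Adj a b → ¬ (((e.symm b : ℕ) : ZMod n) - ((e.symm a : ℕ) : ZMod n) = 1 ∨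
      ((e.symm b : ℕ) : ZMod n) - ((e.symm a : ℕ) : ZMod n) = 2) := by
    rintro a b hab (h | h)
    · rw [hclose a b 1 (by simpa using h), ← he a] at hab
      simp only [he] at hab
      have := (hadj (e.symm a)).1
      rw [he] at this
      exact this hab
    · rw [hclose a b 2 (by simpa using h), ← he a] at hab
      simp only [he] at hab
      have := (hadj (e.symm a)).2
      rw [he] at this
      exact this hab
  have hcast : Function.Injective fun a => ((e.symm a : ℕ) : ZMod n) := by
    intro a b hab
    have := (ZMod.natCast_eq_natCast_iff' _ _ _).1 hab
    rw [Nat.mod_eq_of_lt (e.symm a).2, Nat.mod_eq_of_lt (e.symm b).2] at this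
    exact e.symm.injective (Fin.ext this)
  refine ⟨⟨_, hcast⟩, fun a b hab => ?_⟩
  rw [SimpleGraph.compl_adj]
  refine ⟨fun h => hab.ne (hcast h), ?_⟩
  rw [cycleSq, SimpleGraph.fromRel_adj]
  rintro ⟨-, h | h⟩
  exacts [hnot a b hab h, hnot b a hab.symm h]

theorem HasPattern.contains {n : ℕ} {F : SimpleGraph (Fin n)} {P : Pattern} (h : HasPattern F P)
    (H : SimpleGraph (Fin P.1))
    (hH : ∀ a b, H.Adj a b → ((a : ℕ), (b : ℕ)) ∈ P.2 ∨ ((b : ℕ), (a : ℕ)) ∈ P.2) :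
    Contains F H := by
  obtain ⟨f, hf, hes⟩ := h
  have key : ∀ a b : Fin P.1, ((a : ℕ), (b : ℕ)) ∈ P.2 → F.Adj (f a) (f b) := by
    intro a b hab
    obtain ⟨x, y, hx, hy, hxy⟩ := hes _ hab
    rwa [Fin.ext hx, Fin.ext hy] at hxy
  refine ⟨⟨f, hf⟩, fun a b hab => ?_⟩
  rcases hH a b hab with h | h
  exacts [key a b h, (key b a h).symm]

theorem HasPattern.contains_starG {n m : ℕ} {F : SimpleGraph (Fin n)}
    (h : HasPattern F (starPattern m)) : Contains F (starG m) := by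
  refine h.contains (starG m) fun a b hab => ?_
  replace hab := (SimpleGraph.fromRel_adj _ _ _).1 hab
  have h₁ : (a : ℕ) ≠ b := fun h => hab.1 (Fin.ext h)
  have h₂ : (a : ℕ) < m := a.2
  have h₃ : (b : ℕ) < m := b.2
  simp only [starPattern, List.mem_map, List.mem_range, Prod.mk.injEq]
  rcases hab.2 with h | h
  · exact .inl ⟨b - 1, by lia, by lia, by lia⟩
  · exact .inr ⟨a - 1, by lia, by lia, by lia⟩

theorem HasPattern.contains_top {n m : ℕ} {es : List (ℕ × ℕ)} {F : SimpleGraph (Fin n)}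
    (h : HasPattern F (m, es))
    (hes : ∀ a b : Fin m, a ≠ b → ((a : ℕ), (b : ℕ)) ∈ es ∨ ((b : ℕ), (a : ℕ)) ∈ es) :
    Contains F (⊤ : SimpleGraph (Fin m)) :=
  h.contains ⊤ hes

theorem HasPattern.contains_cyc_four {n : ℕ} {F : SimpleGraph (Fin n)}
    (h : HasPattern F (4, [(0, 1), (1, 2), (2, 3), (0, 3)])) : Contains F (cyc 4) := by
  have key : ∀ a b : Fin 4, a ≠ b ∧ (b - a = 1 ∨ a - b = 1) →
      ((a : ℕ), (b : ℕ)) ∈ [(0, 1), (1, 2), (2, 3), (0, 3)] ∨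
        ((b : ℕ), (a : ℕ)) ∈ [(0, 1), (1, 2), (2, 3), (0, 3)] := by
    decide
  exact h.contains (cyc 4 : SimpleGraph (Fin 4)) key

theorem HasPattern.contains_Kminus_four {n : ℕ} {F : SimpleGraph (Fin n)}
    (h : HasPattern F (4, [(0, 2), (0, 3), (1, 2), (1, 3), (2, 3)])) :
    Contains F (Kminus 4) := by
  refine h.contains (Kminus 4) ?_
  simp only [Kminus, SimpleGraph.sdiff_adj, SimpleGraph.top_adj, SimpleGraph.fromRel_adj]
  decide

theorem HasPattern.contains_Kminus_five {n : ℕ} {F : SimpleGraph (Fin n)}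
    (h : HasPattern F
      (5, [(0, 2), (0, 3), (0, 4), (1, 2), (1, 3), (1, 4), (2, 3), (2, 4), (3, 4)])) :
    Contains F (Kminus 5) := by
  refine h.contains (Kminus 5) ?_
  simp only [Kminus, SimpleGraph.sdiff_adj, SimpleGraph.top_adj, SimpleGraph.fromRel_adj]
  decide

theorem HasPattern.contains_bowtie {n : ℕ} {F : SimpleGraph (Fin n)}
    (h : HasPattern F (5, [(0, 1), (0, 2), (0, 3), (0, 4), (1, 2), (3, 4)])) :
    Contains F bowtie := by
  refine h.contains bowtie ?_
  simp only [bowtie, SimpleGraph.fromRel_adj]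
  decide

theorem HasPattern.contains_joinStar {n : ℕ} {F : SimpleGraph (Fin n)}
    (h : HasPattern F (5, [(0, 1), (0, 2), (0, 3), (0, 4), (1, 2), (1, 3), (1, 4)])) :
    Contains F (joinStar 5 2) := by
  refine h.contains (joinStar 5 2) ?_
  simp only [joinStar, SimpleGraph.fromRel_adj]
  decide

end CycleSqPacking

/-- For `6 ≤ n ≤ 15`, the complement of `C_n²` contains a copy of every
graph `F` on `n` vertices with `n − 3` edges, unless `F` contains one of the graphs of the
family `𝓕_n` as a subgraph. -/
theorem stmt3 (n : ℕ) (h6 : 6 ≤ n) (h15 : n ≤ 15) (F : SimpleGraph (Fin n))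
    (he : F.edgeSet.ncard = n - 3) :
    Contains (cycleSq n)ᶜ F ∨
      (n = 6 ∧ Contains F (starG 3)) ∨
      (n = 7 ∧ (Contains F (starG 4) ∨ Contains F (cyc 4) ∨
        Contains F (⊤ : SimpleGraph (Fin 3)))) ∨
      (n = 8 ∧ (Contains F (⊤ : SimpleGraph (Fin 3)) ∨ Contains F (starG 5))) ∨
      (n = 9 ∧ (Contains F (Kminus 4) ∨ Contains F (starG 6) ∨ Contains F bowtie)) ∨
      (n = 10 ∧ (Contains F (⊤ : SimpleGraph (Fin 4)) ∨ Contains F (starG 7) ∨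
        Contains F (joinStar 5 2))) ∨
      (n = 11 ∧ (Contains F (⊤ : SimpleGraph (Fin 4)) ∨ Contains F (starG 8))) ∨
      (n = 12 ∧ (Contains F (Kminus 5) ∨ Contains F (starG 9))) ∨
      (n = 13 ∧ (Contains F (starG 10) ∨ Contains F (⊤ : SimpleGraph (Fin 5)))) ∨
      (n = 14 ∧ (Contains F (starG 11) ∨ Contains F (⊤ : SimpleGraph (Fin 5)))) ∨
      (n = 15 ∧ Contains F (starG 12)) := by
  rcases CycleSqPacking.isPackable_or_hasPattern (by lia) h15 F he.le with h | ⟨P, hP, h⟩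
  · exact .inl h.contains
  · right
    interval_cases n <;>
      simp only [CycleSqPacking.family, List.mem_cons, List.not_mem_nil, or_false] at hP <;>
      simp only [Nat.reduceEqDiff, false_and, true_and, false_or, or_false]
    · subst hP
      exact h.contains_starG
    · rcases hP with rfl | rfl | rfl
      exacts [.inl h.contains_starG, .inr (.inl h.contains_cyc_four),
        .inr (.inr (h.contains_top (by decide)))]
    · rcases hP with rfl | rfl
      exacts [.inl (h.contains_top (by decide)), .inr h.contains_starG]
    · rcases hP with rfl | rfl | rfl
      exacts [.inl h.contains_Kminus_four, .inr (.inl h.contains_starG),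
        .inr (.inr h.contains_bowtie)]
    · rcases hP with rfl | rfl | rfl
      exacts [.inl (h.contains_top (by decide)), .inr (.inl h.contains_starG),
        .inr (.inr h.contains_joinStar)]
    · rcases hP with rfl | rfl
      exacts [.inl (h.contains_top (by decide)), .inr h.contains_starG]
    · rcases hP with rfl | rfl
      exacts [.inl h.contains_Kminus_five, .inr h.contains_starG]
    · rcases hP with rfl | rfl
      exacts [.inl h.contains_starG, .inr (h.contains_top (by decide))]
    · rcases hP with rfl | rfl
      exacts [.inl h.contains_starG, .inr (h.contains_top (by decide))]
    · subst hP
      exact h.contains_starG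
end

section
/- Let n ≥ 15. Then the complement of C_n² contains (a copy of) every graph F on n vertices with n−3 edges, unless F contains the star S_{n−3} as a subgraph. -/
set_option linter.unusedSectionVars false

namespace CyclePacking

open Finset

variable {V : Type*} [DecidableEq V] (G : SimpleGraph V) [DecidableRel G.Adj]

/-- The degree of `v` into the finite set `A`. -/
def deg (A : Finset V) (v : V) : ℕ := (A.filter (G.Adj v)).card

/-- The sum of the degrees of the subgraph induced on `A`. -/
def degSum (A : Finset V) : ℕ := ∑ v ∈ A, deg G A v

/-- The vertices of `A` can be placed at distinct positions of a cycle of length `m`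
so that adjacent vertices are at distance at least 3. -/
def Placeable (A : Finset V) (m : ℕ) : Prop :=
  ∃ p : V → ℕ, Set.InjOn p A ∧ (∀ a ∈ A, p a < m) ∧
    ∀ a ∈ A, ∀ b ∈ A, G.Adj a b → p a < p b → p a + 3 ≤ p b ∧ p b + 3 ≤ p a + m

variable {G}

lemma deg_mono {A B : Finset V} (h : A ⊆ B) (v : V) : deg G A v ≤ deg G B v :=
  card_le_card (filter_subset_filter _ h)

lemma deg_erase_of_adj {A : Finset V} {u v : V} (hu : u ∈ A) (h : G.Adj v u) :
    deg G (A.erase u) v + 1 = deg G A v := by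
  unfold deg
  rw [filter_erase, card_erase_add_one]
  simp [hu, h]

lemma deg_erase_of_not_adj {A : Finset V} {u v : V} (h : ¬ G.Adj v u) :
    deg G (A.erase u) v = deg G A v := by
  unfold deg
  rw [filter_erase, erase_eq_of_notMem]
  simp [h]

lemma degSum_erase {A : Finset V} {u : V} (hu : u ∈ A) :
    degSum G A = degSum G (A.erase u) + 2 * deg G A u := by
  have h1 : degSum G A = deg G A u + ∑ v ∈ A.erase u, deg G A v :=
    (add_sum_erase A _ hu).symm
  have h2 : ∀ v ∈ A.erase u, deg G A v = deg G (A.erase u) v + if G.Adj u v then 1 else 0 := by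
    intro v _
    split_ifs with h
    · exact (deg_erase_of_adj hu h.symm).symm
    · exact (deg_erase_of_not_adj fun h' => h h'.symm).symm
  rw [h1, sum_congr rfl h2, sum_add_distrib, sum_boole]
  have h3 : deg G A u = deg G (A.erase u) u := (deg_erase_of_not_adj (G.loopless.irrefl u)).symm
  have h4 : #{v ∈ A.erase u | G.Adj u v} = deg G (A.erase u) u := rfl
  simp only [h4, degSum, Nat.cast_id]
  omega

lemma degSum_mono {A B : Finset V} (h : A ⊆ B) : degSum G A ≤ degSum G B :=
  (sum_le_sum fun v _ => deg_mono h v).trans (sum_le_sum_of_subset h)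

lemma card_mul_le_degSum {A : Finset V} {d : ℕ} (h : ∀ v ∈ A, d ≤ deg G A v) :
    #A * d ≤ degSum G A := by
  simpa [degSum] using card_nsmul_le_sum A (deg G A) d h

lemma deg_lt_card {A : Finset V} {u : V} (hu : u ∈ A) : deg G A u < #A :=
  card_lt_card ⟨filter_subset _ _, fun h => by simpa using h hu⟩

lemma exists_adj_of_deg_ne_zero {A : Finset V} {u : V} (h : deg G A u ≠ 0) :
    ∃ v ∈ A, G.Adj u v := by
  obtain ⟨v, hv⟩ := card_ne_zero.mp h
  exact ⟨v, by simpa using hv⟩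

lemma eq_of_deg_le_one {A : Finset V} {u v w : V} (h : deg G A u ≤ 1) (hv : v ∈ A) (hw : w ∈ A)
    (huv : G.Adj u v) (huw : G.Adj u w) : v = w :=
  card_le_one.mp h v (by simp [hv, huv]) w (by simp [hw, huw])

lemma Placeable.mono {A B : Finset V} {m : ℕ} (hB : Placeable G B m) (h : A ⊆ B) :
    Placeable G A m := by
  obtain ⟨p, h1, h2, h3⟩ := hB
  exact ⟨p, h1.mono (coe_subset.2 h), fun a ha => h2 a (h ha),
    fun a ha b hb => h3 a (h ha) b (h hb)⟩

/-- Reduction modulo `m` of numbers smaller than `2 * m`. -/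
def wrap (m x : ℕ) : ℕ := if x < m then x else x - m

/-- A vertex may be put at a free position that avoids its neighbours. -/
lemma Placeable.of_erase_same {A : Finset V} {u : V} {m : ℕ} (hu : u ∈ A)
    (hm : #A + 4 * deg G A u ≤ m) (h : Placeable G (A.erase u) m) : Placeable G A m := by
  obtain ⟨p, hinj, hlt, hadj⟩ := h
  let near : V → Finset ℕ := fun x =>
    {wrap m (p x + 1), wrap m (p x + 2), wrap m (p x + m - 1), wrap m (p x + m - 2)}
  let bad : Finset ℕ := (A.erase u).image p ∪ (A.filter (G.Adj u)).biUnion near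
  have hbad : #bad < #(range m) := by
    have h1 : #bad ≤ #((A.erase u).image p) + #((A.filter (G.Adj u)).biUnion near) :=
      card_union_le _ _
    have h2 : #((A.erase u).image p) ≤ #(A.erase u) := card_image_le
    have h3 : #((A.filter (G.Adj u)).biUnion near) ≤ deg G A u * 4 :=
      card_biUnion_le_card_mul _ _ _ fun _ _ => card_le_four
    have h4 := card_erase_add_one hu
    rw [card_range]
    omega
  obtain ⟨t, htm, ht⟩ := exists_mem_notMem_of_card_lt_card hbad
  rw [mem_range] at htm
  have hfree : ∀ x ∈ A.erase u, p x ≠ t := by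
    intro x hx hxt
    exact ht (mem_union_left _ (mem_image.2 ⟨x, hx, hxt⟩))
  have hfar : ∀ x ∈ A.erase u, G.Adj u x →
      (p x < t → p x + 3 ≤ t ∧ t + 3 ≤ p x + m) ∧ (t < p x → t + 3 ≤ p x ∧ p x + 3 ≤ t + m) := by
    intro x hx hux
    have hn : t ∉ near x := fun hn =>
      ht (mem_union_right _ (mem_biUnion.2 ⟨x, by simp [mem_of_mem_erase hx, hux], hn⟩))
    have h1 := hlt x hx
    simp only [near, mem_insert, mem_singleton, wrap] at hn
    split_ifs at hn <;> omega
  refine ⟨Function.update p u t, ?_, ?_, ?_⟩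
  · intro a ha b hb hab
    by_cases hau : a = u <;> by_cases hbu : b = u
    · rw [hau, hbu]
    · subst hau
      rw [Function.update_self, Function.update_of_ne hbu] at hab
      exact absurd hab.symm (hfree b (mem_erase.2 ⟨hbu, hb⟩))
    · subst hbu
      rw [Function.update_self, Function.update_of_ne hau] at hab
      exact absurd hab (hfree a (mem_erase.2 ⟨hau, ha⟩))
    · rw [Function.update_of_ne hau, Function.update_of_ne hbu] at hab
      exact hinj (by simpa [hau] using ha) (by simpa [hbu] using hb) hab
  · intro a ha
    by_cases hau : a = u
    · subst hau; simpa using htm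
    · simpa [hau] using hlt a (mem_erase.2 ⟨hau, ha⟩)
  · intro a ha b hb hab hpab
    by_cases hau : a = u <;> by_cases hbu : b = u
    · subst hau; subst hbu; exact absurd hab (G.loopless.irrefl _)
    · subst hau
      rw [Function.update_self, Function.update_of_ne hbu] at *
      exact (hfar b (mem_erase.2 ⟨hbu, hb⟩) hab).2 hpab
    · subst hbu
      rw [Function.update_self, Function.update_of_ne hau] at *
      exact (hfar a (mem_erase.2 ⟨hau, ha⟩) hab.symm).1 hpab
    · rw [Function.update_of_ne hau, Function.update_of_ne hbu] at *
      exact hadj a (mem_erase.2 ⟨hau, ha⟩) b (mem_erase.2 ⟨hbu, hb⟩) hab hpab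

/-- A vertex of small degree may be inserted between two consecutive positions of the cycle. -/
lemma Placeable.of_erase {A : Finset V} {u : V} {m : ℕ} (hu : u ∈ A)
    (hm : 4 * deg G A u < m) (h : Placeable G (A.erase u) m) : Placeable G A (m + 1) := by
  obtain ⟨p, hinj, hlt, hadj⟩ := h
  let near : V → Finset ℕ := fun x =>
    {wrap m (m - p x), wrap m (m + 1 - p x), wrap m (2 * m - 1 - p x), wrap m (2 * m - 2 - p x)}
  have hbad : #((A.filter (G.Adj u)).biUnion near) < #(range m) := by
    have h3 : #((A.filter (G.Adj u)).biUnion near) ≤ deg G A u * 4 :=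
      card_biUnion_le_card_mul _ _ _ fun _ _ => card_le_four
    rw [card_range]
    omega
  obtain ⟨r, hrm, hr⟩ := exists_mem_notMem_of_card_lt_card hbad
  rw [mem_range] at hrm
  have hfar : ∀ x ∈ A.erase u, G.Adj u x →
      2 ≤ wrap m (p x + r) ∧ wrap m (p x + r) + 3 ≤ m := by
    intro x hx hux
    have hn : r ∉ near x := fun hn =>
      hr (mem_biUnion.2 ⟨x, by simp [mem_of_mem_erase hx, hux], hn⟩)
    have h1 := hlt x hx
    simp only [near, mem_insert, mem_singleton, wrap] at hn
    unfold wrap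
    split_ifs at hn ⊢ <;> omega
  have hwlt : ∀ x ∈ A.erase u, wrap m (p x + r) < m := by
    intro x hx
    have h1 := hlt x hx
    unfold wrap
    split_ifs <;> omega
  refine ⟨Function.update (fun x => wrap m (p x + r)) u m, ?_, ?_, ?_⟩
  · intro a ha b hb hab
    by_cases hau : a = u <;> by_cases hbu : b = u
    · rw [hau, hbu]
    · subst hau
      rw [Function.update_self, Function.update_of_ne hbu] at hab
      exact absurd hab (hwlt b (mem_erase.2 ⟨hbu, hb⟩)).ne'
    · subst hbu
      rw [Function.update_self, Function.update_of_ne hau] at hab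
      exact absurd hab (hwlt a (mem_erase.2 ⟨hau, ha⟩)).ne
    · rw [Function.update_of_ne hau, Function.update_of_ne hbu] at hab
      refine hinj (by simpa [hau] using ha) (by simpa [hbu] using hb) ?_
      have h1 := hlt a (mem_erase.2 ⟨hau, ha⟩)
      have h2 := hlt b (mem_erase.2 ⟨hbu, hb⟩)
      simp only [wrap] at hab
      split_ifs at hab <;> omega
  · intro a ha
    by_cases hau : a = u
    · subst hau; simp
    · simpa [hau] using (hwlt a (mem_erase.2 ⟨hau, ha⟩)).trans (Nat.lt_succ_self m)
  · intro a ha b hb hab hpab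
    by_cases hau : a = u <;> by_cases hbu : b = u
    · subst hau; subst hbu; exact absurd hab (G.loopless.irrefl _)
    · subst hau
      rw [Function.update_self, Function.update_of_ne hbu] at *
      exact absurd hpab (hwlt b (mem_erase.2 ⟨hbu, hb⟩)).not_gt
    · subst hbu
      rw [Function.update_self, Function.update_of_ne hau] at *
      have := hfar a (mem_erase.2 ⟨hau, ha⟩) hab.symm
      omega
    · rw [Function.update_of_ne hau, Function.update_of_ne hbu] at *
      have ha' := mem_erase.2 ⟨hau, ha⟩
      have hb' := mem_erase.2 ⟨hbu, hb⟩
      have h1 := hlt a ha'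
      have h2 := hlt b hb'
      have h3 := hadj a ha' b hb' hab
      have h4 := hadj b hb' a ha' hab.symm
      simp only [wrap] at hpab ⊢
      split_ifs at hpab ⊢ <;> omega

/-- Vertices can be placed at every third position. -/
lemma Placeable.of_three_mul_card_le {A : Finset V} {m : ℕ} (h : 3 * #A ≤ m) :
    Placeable G A m := by
  let e := A.equivFin
  have key : ∀ a (ha : a ∈ A), (if h : a ∈ A then 3 * (e ⟨a, h⟩ : ℕ) else 0) = 3 * (e ⟨a, ha⟩ : ℕ) :=
    fun a ha => dif_pos ha
  refine ⟨fun a => if h : a ∈ A then 3 * (e ⟨a, h⟩ : ℕ) else 0, ?_, ?_, ?_⟩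
  · intro a ha b hb hab
    simp only at hab
    rw [key a ha, key b hb] at hab
    have : e ⟨a, ha⟩ = e ⟨b, hb⟩ := Fin.ext (by omega)
    simpa using e.injective this
  · intro a ha
    simp only
    rw [key a ha]
    have := (e ⟨a, ha⟩).2
    omega
  · intro a ha b hb _ hlt
    simp only at hlt ⊢
    rw [key a ha, key b hb] at *
    have := (e ⟨b, hb⟩).2
    omega

lemma exists_min_deg {A : Finset V} (h : A.Nonempty) :
    ∃ u ∈ A, (∀ v ∈ A, deg G A u ≤ deg G A v) ∧ #A * deg G A u ≤ degSum G A ∧ deg G A u < #A := by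
  obtain ⟨u, hu, hmin⟩ := exists_min_image A (deg G A) h
  exact ⟨u, hu, hmin, card_mul_le_degSum hmin, deg_lt_card hu⟩

lemma Placeable.of_erase_pred {A : Finset V} {u : V} {m : ℕ} (hu : u ∈ A)
    (hm : 4 * deg G A u + 1 < m) (h : Placeable G (A.erase u) (m - 1)) : Placeable G A m := by
  have := h.of_erase hu (by omega)
  rwa [Nat.sub_add_cancel (by omega)] at this

/-- At most `m - 6` edges and at least four spare positions. -/
lemma placeable_of_degSum_add_twelve_le {A : Finset V} {m : ℕ} (hf : #A + 4 ≤ m)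
    (hs : degSum G A + 12 ≤ 2 * m) : Placeable G A m := by
  induction A using Finset.strongInduction generalizing m with
  | H A ih =>
    by_cases h3 : 3 * #A ≤ m
    · exact .of_three_mul_card_le h3
    have hne : A.Nonempty := card_pos.1 (by omega)
    obtain ⟨u, hu, hmin, hcd, hlt⟩ := exists_min_deg (G := G) hne
    have hc := card_erase_add_one hu
    have hd := degSum_erase (G := G) hu
    by_cases h1 : deg G A u ≤ 1
    · exact .of_erase_same hu (by omega) (ih _ (erase_ssubset hu) (by omega) (by omega))
    by_cases hm : 4 * deg G A u + 1 < m
    · exact .of_erase_pred hu hm (ih _ (erase_ssubset hu) (by omega) (by omega))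
    exfalso
    generalize deg G A u = d at *
    generalize #A = k at *
    have h2 : (m + 1) * (m - 1) ≤ 3 * k * (4 * d) := Nat.mul_le_mul (by omega) (by omega)
    obtain ⟨n, rfl⟩ : ∃ n, m = n + 1 := ⟨m - 1, by omega⟩
    rw [Nat.add_sub_cancel] at h2
    have h4 : n < 13 := by nlinarith
    have h5 : 2 ≤ d := by omega
    have h6 : k * 2 ≤ k * d := Nat.mul_le_mul_left _ h5
    have h7 : n = 12 ∨ n ≤ 11 := by omega
    have h8 : 3 ≤ d := by omega
    have h9 : k * 3 ≤ k * d := Nat.mul_le_mul_left _ h8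
    omega

/-- All vertices have a neighbour in the induced graph. -/
def NoIsolated (G : SimpleGraph V) [DecidableRel G.Adj] (A : Finset V) : Prop :=
  ∀ v ∈ A, deg G A v ≠ 0

/-- The set of vertices of `A` with a neighbour in `A`. -/
def core (G : SimpleGraph V) [DecidableRel G.Adj] (A : Finset V) : Finset V :=
  A.filter fun v => deg G A v ≠ 0

lemma core_subset (A : Finset V) : core G A ⊆ A := filter_subset _ _

lemma mem_core {A : Finset V} {v : V} : v ∈ core G A ↔ v ∈ A ∧ deg G A v ≠ 0 := mem_filter

lemma deg_core (A : Finset V) (v : V) (hv : v ∈ A) : deg G (core G A) v = deg G A v := by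
  unfold deg
  congr 1
  ext w
  simp only [mem_filter, mem_core]
  refine ⟨fun h => ⟨h.1.1, h.2⟩, fun h => ⟨⟨h.1, card_ne_zero.2 ⟨v, ?_⟩⟩, h.2⟩⟩
  simp [hv, h.2.symm]

lemma noIsolated_core (A : Finset V) : NoIsolated G (core G A) := by
  intro v hv
  rw [deg_core A v (core_subset A hv)]
  exact (mem_core.1 hv).2

lemma card_le_degSum {A : Finset V} (h : NoIsolated G A) : #A ≤ degSum G A := by
  simpa using card_mul_le_degSum (d := 1) fun v hv => Nat.one_le_iff_ne_zero.2 (h v hv)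

/-- Isolated vertices may be ignored. -/
lemma Placeable.of_core {A : Finset V} {m : ℕ} (hA : #A ≤ m) (h : Placeable G (core G A) m) :
    Placeable G A m := by
  induction A using Finset.strongInduction with
  | H A ih =>
    by_cases hA0 : NoIsolated G A
    · rwa [core, filter_true_of_mem hA0] at h
    · simp only [NoIsolated, not_forall, not_not] at hA0
      obtain ⟨u, hu, hu0⟩ := hA0
      have hna : ∀ v ∈ A, ¬ G.Adj v u := fun v hv hvu => by
        have : v ∈ A.filter (G.Adj u) := by simp [hv, hvu.symm]
        rw [card_eq_zero.1 hu0] at this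
        simp at this
      have hc := card_erase_add_one hu
      refine .of_erase_same hu (by omega) (ih _ (erase_ssubset hu) (by omega) (h.mono ?_))
      intro v hv
      rw [mem_core, mem_erase] at hv
      exact mem_core.2 ⟨hv.1.2, by rw [← deg_erase_of_not_adj (hna v hv.1.2)]; exact hv.2⟩

lemma card_core_erase {A : Finset V} (hA : NoIsolated G A) {u : V} (hu : u ∈ A) :
    #A ≤ #(core G (A.erase u)) + 1 + deg G A u := by
  have h : A.erase u ⊆ core G (A.erase u) ∪ A.filter (G.Adj u) := by
    intro v hv
    by_cases hvu : G.Adj u v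
    · exact mem_union_right _ (by simp [mem_of_mem_erase hv, hvu])
    · refine mem_union_left _ (mem_core.2 ⟨hv, ?_⟩)
      rw [deg_erase_of_not_adj fun h => hvu h.symm]
      exact hA v (mem_of_mem_erase hv)
  have h1 := (card_le_card h).trans (card_union_le _ _)
  have h2 := card_erase_add_one hu
  unfold deg
  omega

lemma NoIsolated.erase {A : Finset V} {u : V} (hu : u ∈ A) (h : ∀ v ∈ A, 2 ≤ deg G A v) :
    NoIsolated G (A.erase u) := by
  intro v hv
  have h1 := h v (mem_of_mem_erase hv)
  by_cases hvu : G.Adj v u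
  · have := deg_erase_of_adj hu hvu
    omega
  · rw [deg_erase_of_not_adj hvu]
    omega

/-- At most `m - 5` edges, no isolated vertices and at most four spare positions. -/
lemma placeable_of_le_card_add_four {A : Finset V} {m : ℕ} (hA : NoIsolated G A) (hAm : #A ≤ m)
    (hf : m ≤ #A + 4) (hs : degSum G A + 10 ≤ 2 * m) : Placeable G A m := by
  induction A using Finset.strongInduction generalizing m with
  | H A ih =>
    by_cases h0 : 3 * #A ≤ m
    · exact .of_three_mul_card_le h0
    have hne : A.Nonempty := card_pos.1 (by omega)
    obtain ⟨u, hu, hmin, hcd, hlt⟩ := exists_min_deg (G := G) hne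
    have hc := card_erase_add_one hu
    have hd := degSum_erase (G := G) hu
    have hu0 := hA u hu
    have h1 : deg G A u = 1 := by
      by_contra h
      have : #A * 2 ≤ #A * deg G A u := Nat.mul_le_mul_left _ (by omega)
      omega
    by_cases h4 : #A + 4 ≤ m
    · exact .of_erase_same hu (by omega)
        (placeable_of_degSum_add_twelve_le (by omega) (by omega))
    have hcs := card_le_degSum hA
    refine .of_erase_pred hu (by omega) (.of_core (by omega) ?_)
    have hcore := card_core_erase hA hu
    have hle := card_le_card (core_subset (G := G) (A.erase u))
    have hss := degSum_mono (G := G) (core_subset (G := G) (A.erase u))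
    exact ih _ ((core_subset _).trans_ssubset (erase_ssubset hu)) (noIsolated_core _)
      (by omega) (by omega) (by omega)

/-- At most `m - 5` edges and few isolated vertices. -/
lemma placeable_of_core {A : Finset V} {m : ℕ} (hm : 10 ≤ m) (hAm : #A ≤ m)
    (hf : 2 * m < 3 * #(core G A) + 10) (hs : degSum G A + 10 ≤ 2 * m) : Placeable G A m := by
  refine .of_core hAm ?_
  have hA := noIsolated_core (G := G) A
  have hle := card_le_card (core_subset (G := G) A)
  have hss := degSum_mono (G := G) (core_subset (G := G) A)
  generalize core G A = B at *
  by_cases h4 : m ≤ #B + 4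
  · exact placeable_of_le_card_add_four hA (by omega) h4 (by omega)
  have hne : B.Nonempty := card_pos.1 (by omega)
  obtain ⟨u, hu, hmin, hcd, hlt⟩ := exists_min_deg (G := G) hne
  have hc := card_erase_add_one hu
  have hd := degSum_erase (G := G) hu
  have hu0 := hA u hu
  by_cases h1 : deg G B u = 1
  · exact .of_erase_same hu (by omega)
      (placeable_of_degSum_add_twelve_le (by omega) (by omega))
  by_cases h2 : deg G B u = 2
  · exact .of_erase_pred hu (by omega)
      (placeable_of_degSum_add_twelve_le (by omega) (by omega))
  have : #B * 3 ≤ #B * deg G B u := Nat.mul_le_mul_left _ (by omega)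
  omega

/-- Extension of a placement along a line by every third position. -/
lemma Placeable.of_linear {S A : Finset V} {c m : ℕ} (q : V → ℕ) (hinj : Set.InjOn q S)
    (hq : ∀ a ∈ S, q a + 3 ≤ c)
    (hadj : ∀ a ∈ S, ∀ b ∈ S, G.Adj a b → q a < q b → q a + 3 ≤ q b)
    (hm : c + 3 * #(A \ S) ≤ m) : Placeable G A m := by
  obtain ⟨e, he⟩ : ∃ e : V → ℕ, Set.InjOn e (A \ S : Finset V) ∧ ∀ a ∈ A \ S, e a < #(A \ S) := by
    let f := (A \ S).equivFin
    refine ⟨fun a => if h : a ∈ A \ S then f ⟨a, h⟩ else 0, ?_, ?_⟩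
    · intro a ha b hb hab
      simp only [dif_pos (mem_coe.1 ha), dif_pos (mem_coe.1 hb)] at hab
      simpa using f.injective (Fin.ext hab)
    · intro a ha
      simp only [dif_pos ha]
      exact (f ⟨a, ha⟩).2
  refine ⟨fun a => if a ∈ S then q a else c + 3 * e a, ?_, ?_, ?_⟩
  · intro a ha b hb hab
    by_cases h1 : a ∈ S <;> by_cases h2 : b ∈ S <;> simp only [h1, h2, if_true, if_false] at hab
    · exact hinj h1 h2 hab
    · have := hq a h1
      omega
    · have := hq b h2
      omega
    · exact he.1 (by simpa [h1] using ha) (by simpa [h2] using hb) (by omega)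
  · intro a ha
    by_cases h1 : a ∈ S <;> simp only [h1, if_true, if_false]
    · have := hq a h1
      omega
    · have := he.2 a (by simp [h1, ha])
      omega
  · intro a ha b hb hab hlt
    by_cases h1 : a ∈ S <;> by_cases h2 : b ∈ S <;>
      simp only [h1, h2, if_true, if_false] at hlt ⊢
    · have := hadj a h1 b h2 hab hlt
      have := hq b h2
      omega
    · have := hq a h1
      have := he.2 b (by simp [h2, hb])
      omega
    · have := hq b h2
      omega
    · have := he.2 b (by simp [h2, hb])
      omega

lemma Placeable.of_pair {A : Finset V} {m : ℕ} {a b : V} (ha : a ∈ A) (hb : b ∈ A) (hab : a ≠ b)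
    (h : ¬ G.Adj a b) (hm : 3 * #A ≤ m + 2) : Placeable G A m := by
  have hs : ({a, b} : Finset V) ⊆ A := by simp [insert_subset_iff, ha, hb]
  have hc : #({a, b} : Finset V) = 2 := card_pair hab
  have hk := card_le_card hs
  refine .of_linear (S := {a, b}) (c := 4) (fun x => if x = a then 0 else 1) ?_ ?_ ?_ ?_
  · intro x hx y hy
    simp only [coe_insert, coe_singleton, Set.mem_insert_iff, Set.mem_singleton_iff] at hx hy
    rcases hx with rfl | rfl <;> rcases hy with rfl | rfl <;> simp [hab.symm]
  · intro x hx
    split_ifs <;> omega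
  · intro x hx y hy hxy
    simp only [mem_insert, mem_singleton] at hx hy
    rcases hx with rfl | rfl <;> rcases hy with rfl | rfl <;> simp_all
  · rw [card_sdiff_of_subset hs]
    omega

lemma Placeable.of_two_pairs {A : Finset V} {m : ℕ} {a b c d : V} (ha : a ∈ A) (hb : b ∈ A)
    (hc : c ∈ A) (hd : d ∈ A) (hab : a ≠ b) (hcd : c ≠ d) (hca : c ≠ a) (hcb : c ≠ b)
    (hda : d ≠ a) (hdb : d ≠ b)
    (h : ¬ G.Adj a b) (h' : ¬ G.Adj c d) (hm : 3 * #A ≤ m + 4) : Placeable G A m := by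
  have hs : ({a, b, c, d} : Finset V) ⊆ A := by simp [insert_subset_iff, ha, hb, hc, hd]
  have hc : #({a, b, c, d} : Finset V) = 4 := by
    rw [card_insert_of_notMem, card_insert_of_notMem, card_pair hcd] <;>
      simp [hab, hca.symm, hcb.symm, hda.symm, hdb.symm]
  have hk := card_le_card hs
  have h2 : ¬ G.Adj b a := fun hh => h hh.symm
  have h2' : ¬ G.Adj d c := fun hh => h' hh.symm
  refine .of_linear (S := {a, b, c, d}) (c := 8)
    (fun x => if x = a then 0 else if x = b then 1 else if x = c then 4 else 5) ?_ ?_ ?_ ?_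
  · intro x hx y hy
    simp only [coe_insert, coe_singleton, Set.mem_insert_iff, Set.mem_singleton_iff] at hx hy
    rcases hx with rfl | rfl | rfl | rfl <;> rcases hy with rfl | rfl | rfl | rfl <;>
      simp_all [Ne.symm]
  · intro x hx
    split_ifs <;> omega
  · intro x hx y hy hxy
    simp only [mem_insert, mem_singleton] at hx hy
    rcases hx with rfl | rfl | rfl | rfl <;> rcases hy with rfl | rfl | rfl | rfl <;>
      simp_all [Ne.symm]
  · rw [card_sdiff_of_subset hs]
    omega

lemma exists_not_adj {A : Finset V} (h : degSum G A < #A * (#A - 1)) :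
    ∃ a ∈ A, ∃ b ∈ A, a ≠ b ∧ ¬ G.Adj a b := by
  by_contra! hcon
  refine h.not_ge (card_mul_le_degSum fun v hv => ?_)
  rw [← card_erase_of_mem hv]
  refine card_le_card fun w hw => ?_
  rw [mem_erase] at hw
  exact mem_filter.2 ⟨hw.2, hcon v hv w hw.2 hw.1.symm⟩

lemma Placeable.of_four_le_deg {A : Finset V} {m : ℕ} (hm : 3 * #A ≤ m + 4)
    (h4 : ∀ v ∈ A, 4 ≤ deg G A v) (h1 : degSum G A < #A * (#A - 1))
    (h2 : degSum G A < 16 + (#A - 2) * (#A - 3)) : Placeable G A m := by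
  obtain ⟨a, ha, b, hb, hab, hnab⟩ := exists_not_adj h1
  have hb' : b ∈ A.erase a := mem_erase.2 ⟨hab.symm, hb⟩
  have e1 := degSum_erase (G := G) ha
  have e2 := degSum_erase (G := G) hb'
  rw [deg_erase_of_not_adj fun h => hnab h.symm] at e2
  have c1 := card_erase_of_mem ha
  have c2 := card_erase_of_mem hb'
  have := h4 a ha
  have := h4 b hb
  obtain ⟨c, hc, d, hd, hcd, hncd⟩ := exists_not_adj (A := (A.erase a).erase b) (G := G) (by
    rw [c2, c1, show #A - 1 - 1 = #A - 2 by omega, show #A - 2 - 1 = #A - 3 by omega]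
    omega)
  simp only [mem_erase] at hc hd
  exact .of_two_pairs ha hb hc.2.2 hd.2.2 hab hcd hc.2.1 hc.1 hd.2.1 hd.1 hnab hncd hm

lemma placeable_fourteen_of_degSum_le_eighteen {A : Finset V} (hA : #A + 4 ≤ 14)
    (hs : degSum G A ≤ 18) : Placeable G A 14 := by
  induction A using Finset.strongInduction with
  | H A ih =>
    by_cases h3 : 3 * #A ≤ 14
    · exact .of_three_mul_card_le h3
    have hne : A.Nonempty := card_pos.1 (by omega)
    obtain ⟨u, hu, hmin, hcd, hlt⟩ := exists_min_deg (G := G) hne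
    have hc := card_erase_add_one hu
    have hd := degSum_erase (G := G) hu
    by_cases h1 : deg G A u ≤ 1
    · exact .of_erase_same hu (by omega) (ih _ (erase_ssubset hu) (by omega) (by omega))
    by_cases h4 : deg G A u ≤ 3
    · exact .of_erase_pred hu (by omega)
        (placeable_of_degSum_add_twelve_le (by omega) (by omega))
    have : #A * 4 ≤ #A * deg G A u := Nat.mul_le_mul_left _ (by omega)
    omega

lemma le_deg_of_min {A : Finset V} {u : V} (hmin : ∀ v ∈ A, deg G A u ≤ deg G A v) {d : ℕ}
    (h : d ≤ deg G A u) : ∀ v ∈ A, d ≤ deg G A v :=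
  fun v hv => h.trans (hmin v hv)

lemma placeable_fourteen_of_degSum_le_twenty {A : Finset V} (hA : NoIsolated G A) (h7 : 7 ≤ #A)
    (hf : #A + 4 ≤ 14) (hs : degSum G A ≤ 20) : Placeable G A 14 := by
  have hne : A.Nonempty := card_pos.1 (by omega)
  obtain ⟨u, hu, hmin, hcd, hlt⟩ := exists_min_deg (G := G) hne
  have hc := card_erase_add_one hu
  have hd := degSum_erase (G := G) hu
  have hu0 := hA u hu
  by_cases h1 : deg G A u ≤ 1
  · exact .of_erase_same hu (by omega)
      (placeable_fourteen_of_degSum_le_eighteen (by omega) (by omega))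
  by_cases h2 : deg G A u ≤ 2
  · have hni := NoIsolated.erase hu (le_deg_of_min hmin (by omega))
    refine .of_erase_pred hu (by omega) (placeable_of_core (by omega) (by omega) ?_ (by omega))
    rw [core, filter_true_of_mem hni]
    omega
  by_cases h4 : deg G A u ≤ 3
  · exact .of_erase_pred hu (by omega)
      (placeable_of_degSum_add_twelve_le (by omega) (by omega))
  have : #A * 4 ≤ #A * deg G A u := Nat.mul_le_mul_left _ (by omega)
  omega

/-- At most `m - 3` edges and at least four spare positions. -/
lemma placeable_of_degSum_add_six_le {A : Finset V} {m : ℕ} (hm : 15 ≤ m) (hf : #A + 4 ≤ m)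
    (hs : degSum G A + 6 ≤ 2 * m) : Placeable G A m := by
  induction A using Finset.strongInduction generalizing m with
  | H A ih =>
    by_cases h3 : 3 * #A ≤ m
    · exact .of_three_mul_card_le h3
    have hne : A.Nonempty := card_pos.1 (by omega)
    obtain ⟨u, hu, hmin, hcd, hlt⟩ := exists_min_deg (G := G) hne
    have hc := card_erase_add_one hu
    have hd := degSum_erase (G := G) hu
    by_cases h1 : deg G A u ≤ 1
    · exact .of_erase_same hu (by omega) (ih _ (erase_ssubset hu) hm (by omega) (by omega))
    by_cases hm16 : 16 ≤ m
    · by_cases hm : 4 * deg G A u + 1 < m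
      · exact .of_erase_pred hu hm
          (ih _ (erase_ssubset hu) (by omega) (by omega) (by omega))
      have h4 := le_deg_of_min hmin (d := 4) (by omega)
      have hm21 : m ≤ 20 := by
        clear ih h4 hmin hc hd hlt h1
        generalize deg G A u = d at *
        generalize #A = k at *
        obtain ⟨n, rfl⟩ : ∃ n, m = n + 1 := ⟨m - 1, by omega⟩
        have h2 : (n + 1 + 1) * n ≤ 3 * k * (4 * d) := Nat.mul_le_mul (by omega) (by omega)
        by_contra
        nlinarith
      have hd5 : deg G A u = 4 ∨ 5 ≤ deg G A u := by omega
      have hk4 : #A * 4 ≤ #A * deg G A u := Nat.mul_le_mul_left _ (by omega)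
      have hk6 : #A = 6 ∧ m ≤ 17 ∨ #A = 7 ∧ m = 17 := by
        rcases hd5 with h | h
        · omega
        · have : #A * 5 ≤ #A * deg G A u := Nat.mul_le_mul_left _ h
          omega
      rcases hk6 with ⟨h, _⟩ | ⟨h, _⟩
      · obtain ⟨a, ha, b, hb, hab, hnab⟩ := exists_not_adj (A := A) (G := G) (by rw [h]; omega)
        exact .of_pair ha hb hab hnab (by omega)
      · exact .of_four_le_deg (by omega) h4 (by rw [h]; omega) (by rw [h]; omega)
    obtain rfl : m = 15 := by omega
    by_cases h3 : deg G A u = 3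
    · exact .of_erase_pred hu (by omega)
        (placeable_fourteen_of_degSum_le_eighteen (by omega) (by omega))
    by_cases h2 : deg G A u = 2
    · by_cases h8 : #A ≤ 7
      · exact .of_erase_same hu (by omega) (ih _ (erase_ssubset hu) hm (by omega) (by omega))
      · exact .of_erase_pred hu (by omega) (placeable_fourteen_of_degSum_le_twenty
          (NoIsolated.erase hu (le_deg_of_min hmin (by omega)))
          (by omega) (by omega) (by omega))
    have h4 := le_deg_of_min hmin (d := 4) (by omega)
    have hk4 : #A * 4 ≤ #A * deg G A u := Nat.mul_le_mul_left _ (by omega)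
    have hk : #A = 6 := by omega
    exact .of_four_le_deg (by omega) h4 (by rw [hk]; omega) (by rw [hk]; omega)

lemma exists_placement_of_matching {A : Finset V} {j : ℕ} (hA : NoIsolated G A)
    (h1 : ∀ v ∈ A, deg G A v ≤ 1) (hc : #A ≤ 2 * j) (hj : j ≤ 3) :
    ∃ p : V → ℕ, Set.InjOn p A ∧ (∀ a ∈ A, p a < j ∨ 3 ≤ p a ∧ p a < j + 3) ∧
      ∀ a ∈ A, ∀ b ∈ A, G.Adj a b → p a < p b → p b = p a + 3 := by
  induction j generalizing A with
  | zero =>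
    obtain rfl : A = ∅ := card_eq_zero.1 (by omega)
    exact ⟨fun _ => 0, by simp⟩
  | succ j ih =>
    rcases A.eq_empty_or_nonempty with rfl | ⟨u, hu⟩
    · exact ⟨fun _ => 0, by simp⟩
    obtain ⟨v, hv, huv⟩ := exists_adj_of_deg_ne_zero (hA u hu)
    have hvu : v ∈ A.erase u := mem_erase.2 ⟨huv.ne', hv⟩
    have hnu : ∀ w ∈ A, G.Adj u w → w = v := fun w hw h =>
      eq_of_deg_le_one (h1 u hu) hw hv h huv
    have hnv : ∀ w ∈ A, G.Adj v w → w = u := fun w hw h =>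
      eq_of_deg_le_one (h1 v hv) hw hu h huv.symm
    have hmem : ∀ w, w ∈ (A.erase u).erase v ↔ w ≠ v ∧ w ≠ u ∧ w ∈ A := by simp
    have hdeg : ∀ w ∈ (A.erase u).erase v, deg G ((A.erase u).erase v) w = deg G A w := by
      intro w hw
      rw [hmem] at hw
      rw [deg_erase_of_not_adj fun h => hw.2.1 (hnv w hw.2.2 h.symm),
        deg_erase_of_not_adj fun h => hw.1 (hnu w hw.2.2 h.symm)]
    have c1 := card_erase_add_one hu
    have c2 := card_erase_add_one hvu
    obtain ⟨p, hinj, hp, hadj⟩ := ih (A := (A.erase u).erase v)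
      (fun w hw => by rw [hdeg w hw]; exact hA w ((hmem w).1 hw).2.2)
      (fun w hw => by rw [hdeg w hw]; exact h1 w ((hmem w).1 hw).2.2) (by omega) (by omega)
    let q : V → ℕ := fun x => if x = u then j else if x = v then j + 3 else p x
    have qu : q u = j := if_pos rfl
    have qv : q v = j + 3 := by simp [q, huv.ne']
    have qo : ∀ x, x ≠ u → x ≠ v → q x = p x := fun x h h' => by simp [q, h, h']
    have hcase : ∀ x ∈ A, x = u ∨ x = v ∨ (x ∈ (A.erase u).erase v ∧ q x = p x) := by
      intro x hx
      by_cases h : x = u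
      · exact .inl h
      by_cases h' : x = v
      · exact .inr (.inl h')
      · exact .inr (.inr ⟨(hmem x).2 ⟨h', h, hx⟩, qo x h h'⟩)
    refine ⟨q, ?_, ?_, ?_⟩
    · intro a ha b hb hab
      rcases hcase a ha with rfl | rfl | ⟨ha', ea⟩ <;> rcases hcase b hb with rfl | rfl | ⟨hb', eb⟩
      · rfl
      · omega
      · have := hp b hb'
        omega
      · omega
      · rfl
      · have := hp b hb'
        omega
      · have := hp a ha'
        omega
      · have := hp a ha'
        omega
      · exact hinj ha' hb' (by omega)
    · intro a ha
      rcases hcase a ha with rfl | rfl | ⟨ha', ea⟩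
      · omega
      · omega
      · have := hp a ha'
        omega
    · intro a ha b hb hab hlt
      rcases hcase a ha with rfl | rfl | ⟨ha', ea⟩
      · rw [hnu b hb hab] at hlt ⊢
        omega
      · rw [hnv b hb hab] at hlt ⊢
        omega
      rcases hcase b hb with rfl | rfl | ⟨hb', eb⟩
      · exact absurd (hnu a ha hab.symm) ((hmem a).1 ha').1
      · exact absurd (hnv a ha hab.symm) ((hmem a).1 ha').2.1
      · have := hadj a ha' b hb' hab (by omega)
        omega

lemma placeable_six_of_matching {A : Finset V} (hA : NoIsolated G A)
    (h1 : ∀ v ∈ A, deg G A v ≤ 1) (hc : #A ≤ 6) : Placeable G A 6 := by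
  obtain ⟨p, hinj, hp, hadj⟩ := exists_placement_of_matching hA h1 (j := 3) hc le_rfl
  refine ⟨p, hinj, fun a ha => ?_, fun a ha b hb hab hlt => ?_⟩
  · have := hp a ha
    omega
  · have := hadj a ha b hb hab hlt
    have := hp a ha
    have := hp b hb
    omega

/-- Two vertices of maximal degree, all other vertices being leaves. -/
lemma placeable_of_two_centres {A : Finset V} {m : ℕ} {y z : V} (hA : NoIsolated G A) (hm : 7 ≤ m)
    (hyA : y ∈ A) (hzA : z ∈ A) (hyz : y ≠ z) (hy : deg G A y + 5 = m) (hz : deg G A z + 5 = m)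
    (h1 : ∀ v ∈ A, v ≠ y → v ≠ z → deg G A v ≤ 1) (hs : degSum G A + 6 ≤ 2 * m) :
    Placeable G A m := by
  have hzy : z ∈ A.erase y := mem_erase.2 ⟨hyz.symm, hzA⟩
  set B := (A.erase y).erase z with hB
  have hmem : ∀ w, w ∈ B ↔ w ≠ z ∧ w ≠ y ∧ w ∈ A := by simp [hB]
  have e1 := degSum_erase (G := G) hyA
  have e2 := degSum_erase (G := G) hzy
  rw [← hB] at e2
  have hyy : deg G (A.erase y) y = deg G A y := deg_erase_of_not_adj (G.loopless.irrefl y)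
  have hzz : deg G B z = deg G (A.erase y) z := deg_erase_of_not_adj (G.loopless.irrefl z)
  have hle : ∀ x ∈ B, deg G B x ≤ degSum G B := fun x hx =>
    single_le_sum (f := deg G B) (fun _ _ => Nat.zero_le _) hx
  have hone : ∀ x ∈ B, ∀ w ∈ A, ∀ w' ∈ A, G.Adj x w → G.Adj x w' → w = w' :=
    fun x hx w hw w' hw' h h' =>
      eq_of_deg_le_one (h1 x ((hmem x).1 hx).2.2 ((hmem x).1 hx).2.1 ((hmem x).1 hx).1) hw hw' h h'
  have hny : ∀ w ∈ B, G.Adj y w ↔ w ∈ B.filter (G.Adj y) := fun w hw => by simp [hw]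
  have hnz : ∀ w ∈ B, G.Adj z w ↔ w ∈ B.filter (G.Adj z) := fun w hw => by simp [hw]
  have hyB : ∀ w ∈ B.filter (G.Adj y), w ∈ B ∧ G.Adj y w := fun w hw => by simpa using hw
  have hzB : ∀ w ∈ B.filter (G.Adj z), w ∈ B ∧ G.Adj z w := fun w hw => by simpa using hw
  have hcases : ∀ x ∈ A, x = y ∨ x = z ∨ x ∈ B := fun x hx => by
    rw [hmem]
    tauto
  have hnone : degSum G B = 0 → ∀ x ∈ B, ∀ w ∈ B, ¬ G.Adj x w := by
    intro h0 x hx w hw hxw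
    have h2 := hle x hx
    rw [h0, Nat.le_zero] at h2
    have : w ∈ B.filter (G.Adj x) := by simp [hw, hxw]
    rw [card_eq_zero.1 h2] at this
    simp at this
  have hcov : degSum G B = 0 → ∀ x ∈ B, x ∈ B.filter (G.Adj y) ∨ x ∈ B.filter (G.Adj z) := by
    intro h0 x hx
    obtain ⟨w, hw, hxw⟩ := exists_adj_of_deg_ne_zero (hA x ((hmem x).1 hx).2.2)
    rcases hcases w hw with rfl | rfl | hw'
    · exact .inl (by simp [hx, hxw.symm])
    · exact .inr (by simp [hx, hxw.symm])
    · exact absurd hxw (hnone h0 x hx w hw')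
  have hfin : ∀ p : V → ℕ, Set.InjOn p A → (∀ a ∈ A, p a < m) →
      (G.Adj y z → p y + 3 ≤ p z ∧ p z + 3 ≤ p y + m) →
      (∀ w ∈ B.filter (G.Adj y), p y + 3 ≤ p w ∧ p w + 3 ≤ p y + m ∨
        p w + 3 ≤ p y ∧ p y + 3 ≤ p w + m) →
      (∀ w ∈ B.filter (G.Adj z), p z + 3 ≤ p w ∧ p w + 3 ≤ p z + m ∨
        p w + 3 ≤ p z ∧ p z + 3 ≤ p w + m) →
      (∀ x ∈ B, ∀ w ∈ B, G.Adj x w → p x < p w → p x + 3 ≤ p w ∧ p w + 3 ≤ p x + m) →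
      Placeable G A m := by
    intro p h1 h2 h3 h4 h5 h6
    refine ⟨p, h1, h2, fun a ha b hb hab hlt => ?_⟩
    rcases hcases a ha with e | e | ha' <;> rcases hcases b hb with e' | e' | hb'
    · exact absurd (e.trans e'.symm) hab.ne
    · rw [e, e'] at hab hlt ⊢
      exact h3 hab
    · rw [e] at hab hlt ⊢
      have := h4 b ((hny b hb').1 hab)
      omega
    · rw [e, e'] at hab hlt ⊢
      have := h3 hab.symm
      omega
    · exact absurd (e.trans e'.symm) hab.ne
    · rw [e] at hab hlt ⊢
      have := h5 b ((hnz b hb').1 hab)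
      omega
    · rw [e'] at hab hlt ⊢
      have := h4 a ((hny a ha').1 hab.symm)
      omega
    · rw [e'] at hab hlt ⊢
      have := h5 a ((hnz a ha').1 hab.symm)
      omega
    · exact h6 a ha' b hb' hab hlt
  have hdisj : ∀ a ∈ B.filter (G.Adj y), ∀ b ∈ B.filter (G.Adj z),
      a ≠ b ∧ a ≠ y ∧ a ≠ z ∧ b ≠ y ∧ b ≠ z := by
    intro a ha b hb
    obtain ⟨ha, hya⟩ := hyB a ha
    obtain ⟨hb, hzb⟩ := hzB b hb
    have ha' := (hmem a).1 ha
    have hb' := (hmem b).1 hb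
    refine ⟨?_, ha'.2.1, ha'.1, hb'.2.1, hb'.1⟩
    rintro rfl
    exact hyz (hone a ha y hyA z hzA hya.symm hzb.symm)
  have hsix : ∀ a b c d : V, ∀ i j k l r t : ℕ, a ≠ b → c ≠ d → B.filter (G.Adj y) = {a, b} →
      B.filter (G.Adj z) = {c, d} → ∃ p : V → ℕ, p y = i ∧ p z = j ∧ p a = k ∧ p b = l ∧ p c = r ∧
        p d = t := by
    intro a b c d i j k l r t hab hcd hNy hNz
    obtain ⟨n1, n2, n3, n4, n5⟩ := hdisj a (by simp [hNy]) c (by simp [hNz])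
    obtain ⟨n6, n7, n8, n9, n10⟩ := hdisj b (by simp [hNy]) d (by simp [hNz])
    obtain ⟨n11, -⟩ := hdisj a (by simp [hNy]) d (by simp [hNz])
    obtain ⟨n12, -⟩ := hdisj b (by simp [hNy]) c (by simp [hNz])
    exact ⟨fun x => if x = y then i else if x = z then j else if x = a then k else if x = b then l
      else if x = c then r else t, by simp [*, Ne.symm, hyz.symm, hab.symm, hcd.symm, n1.symm,
        n6.symm, n11.symm, n12.symm]⟩
  by_cases hadj : G.Adj y z
  · have d1 := deg_erase_of_adj hzy hadj
    have d2 := deg_erase_of_adj hyA hadj.symm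
    rw [← hB] at d1
    have hm8 : m = 7 ∨ m = 8 := by omega
    rcases hm8 with rfl | rfl
    · obtain ⟨a, hNy⟩ := card_eq_one.1 (show #(B.filter (G.Adj y)) = 1 by unfold deg at *; omega)
      obtain ⟨b, hNz⟩ := card_eq_one.1 (show #(B.filter (G.Adj z)) = 1 by unfold deg at *; omega)
      obtain ⟨n1, n2, n3, n4, n5⟩ := hdisj a (by simp [hNy]) b (by simp [hNz])
      have haB := hyB a (by simp [hNy])
      have hbB := hzB b (by simp [hNz])
      have haN : ∀ x ∈ B, ¬ G.Adj a x := fun x hx h =>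
        ((hmem x).1 hx).2.1 (hone a haB.1 x ((hmem x).1 hx).2.2 y hyA h haB.2.symm)
      have hbN : ∀ x ∈ B, ¬ G.Adj b x := fun x hx h =>
        ((hmem x).1 hx).1 (hone b hbB.1 x ((hmem x).1 hx).2.2 z hzA h hbB.2.symm)
      let E := (B.erase a).erase b
      have hE : ∀ x, x ∈ E ↔ x ≠ b ∧ x ≠ a ∧ x ∈ B := by simp [E]
      have hEc : #E ≤ 2 := by
        have h1 : #E * 1 ≤ degSum G E := card_mul_le_degSum fun x hx => by
          have hx' := (hE x).1 hx
          have hxB := (hmem x).1 hx'.2.2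
          rw [Nat.one_le_iff_ne_zero, deg_erase_of_not_adj fun h => hbN x hx'.2.2 h.symm,
            deg_erase_of_not_adj fun h => haN x hx'.2.2 h.symm, deg_erase_of_not_adj,
            deg_erase_of_not_adj]
          · exact hA x hxB.2.2
          · intro h
            have := (hny x hx'.2.2).1 h.symm
            rw [hNy, mem_singleton] at this
            exact hx'.2.1 this
          · intro h
            have := (hnz x hx'.2.2).1 h.symm
            rw [hNz, mem_singleton] at this
            exact hx'.1 this
        have h2 : degSum G E ≤ degSum G B :=
          degSum_mono ((erase_subset _ _).trans (erase_subset _ _))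
        omega
      obtain ⟨e, he1, he2⟩ : ∃ e : V → ℕ, Set.InjOn e E ∧ ∀ x ∈ E, e x = 1 ∨ e x = 5 := by
        let f := E.equivFin
        refine ⟨fun x => if h : x ∈ E then 1 + 4 * f ⟨x, h⟩ else 0, ?_, ?_⟩
        · intro u hu v hv huv
          simp only [dif_pos (mem_coe.1 hu), dif_pos (mem_coe.1 hv)] at huv
          simpa using f.injective (Fin.ext (show (f ⟨u, hu⟩ : ℕ) = f ⟨v, hv⟩ by omega))
        · intro u hu
          simp only [dif_pos hu]
          have := (f ⟨u, hu⟩).2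
          omega
      obtain ⟨p, py, pz, pa, pb, pE⟩ : ∃ p : V → ℕ, p y = 3 ∧ p z = 6 ∧ p a = 0 ∧ p b = 2 ∧
          ∀ x ∈ E, p x = e x := by
        refine ⟨fun x => if x = y then 3 else if x = z then 6 else if x = a then 0 else
          if x = b then 2 else e x, by simp, by simp [hyz.symm], by simp [n2, n3],
          by simp [n1.symm, n4, n5], fun x hx => ?_⟩
        have hx' := (hE x).1 hx
        have hxB := (hmem x).1 hx'.2.2
        simp [hx'.1, hx'.2.1, hxB.1, hxB.2.1]
      have hall : ∀ x ∈ B, x = a ∨ x = b ∨ x ∈ E := by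
        intro x hx
        rw [hE]
        tauto
      refine hfin p ?_ ?_ ?_ ?_ ?_ ?_
      · intro u hu v hv huv
        have hall' : ∀ x ∈ A, x = y ∨ x = z ∨ x = a ∨ x = b ∨ (x ∈ E ∧ p x = e x) := by
          intro x hx
          rcases hcases x hx with h | h | h
          · exact .inl h
          · exact .inr (.inl h)
          · rcases hall x h with h | h | h
            · exact .inr (.inr (.inl h))
            · exact .inr (.inr (.inr (.inl h)))
            · exact .inr (.inr (.inr (.inr ⟨h, pE x h⟩)))
        rcases hall' u hu with h | h | h | h | ⟨h, k⟩ <;>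
          rcases hall' v hv with h' | h' | h' | h' | ⟨h', k'⟩
        case inr.inr.inr.inr.inr.inr.inr.inr => exact he1 h h' (by omega)
        all_goals
          first
          | exact h.trans h'.symm
          | (rw [h, h'] at huv; omega)
          | (rw [h] at huv; have := he2 v h'; omega)
          | (rw [h'] at huv; have := he2 u h; omega)
      · intro u hu
        rcases hcases u hu with h | h | h
        · rw [h]; omega
        · rw [h]; omega
        · rcases hall u h with h | h | h
          · rw [h]; omega
          · rw [h]; omega
          · have := he2 u h
            rw [pE u h]; omega
      · intro
        omega
      · rw [hNy]
        simp only [mem_singleton, forall_eq]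
        omega
      · rw [hNz]
        simp only [mem_singleton, forall_eq]
        omega
      · intro x hx w hw hxw hlt
        rcases hall x hx with h | h | h
        · exact absurd (h ▸ hxw) (haN w hw)
        · exact absurd (h ▸ hxw) (hbN w hw)
        rcases hall w hw with h' | h' | h'
        · exact absurd (h' ▸ hxw.symm) (haN x hx)
        · exact absurd (h' ▸ hxw.symm) (hbN x hx)
        rw [pE x h, pE w h'] at hlt ⊢
        have := he2 x h
        have := he2 w h'
        omega
    · obtain ⟨a, b, hab, hNy⟩ :=
        card_eq_two.1 (show #(B.filter (G.Adj y)) = 2 by unfold deg at *; omega)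
      obtain ⟨c, d, hcd, hNz⟩ :=
        card_eq_two.1 (show #(B.filter (G.Adj z)) = 2 by unfold deg at *; omega)
      have h0 : degSum G B = 0 := by omega
      obtain ⟨p, py, pz, pa, pb, pc, pd⟩ := hsix a b c d 0 4 3 5 1 7 hab hcd hNy hNz
      have hall : ∀ x ∈ A, x = y ∨ x = z ∨ x = a ∨ x = b ∨ x = c ∨ x = d := by
        intro x hx
        rcases hcases x hx with h | h | h
        · exact .inl h
        · exact .inr (.inl h)
        · have := hcov h0 x h
          simp only [hNy, hNz, mem_insert, mem_singleton] at this
          tauto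
      refine hfin p ?_ ?_ ?_ ?_ ?_ fun x hx w hw hxw => absurd hxw (hnone h0 x hx w hw)
      · intro u hu v hv huv
        rcases hall u hu with h | h | h | h | h | h <;>
          rcases hall v hv with h' | h' | h' | h' | h' | h' <;> rw [h, h'] at huv ⊢ <;> omega
      · intro u hu
        rcases hall u hu with h | h | h | h | h | h <;> rw [h] <;> omega
      · intro
        omega
      · rw [hNy]
        simp only [mem_insert, mem_singleton, forall_eq_or_imp, forall_eq]
        omega
      · rw [hNz]
        simp only [mem_insert, mem_singleton, forall_eq_or_imp, forall_eq]
        omega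
  · have d1 : deg G B y = deg G (A.erase y) y := deg_erase_of_not_adj hadj
    have d2 : deg G (A.erase y) z = deg G A z := deg_erase_of_not_adj fun h => hadj h.symm
    obtain rfl : m = 7 := by omega
    obtain ⟨a, b, hab, hNy⟩ :=
      card_eq_two.1 (show #(B.filter (G.Adj y)) = 2 by unfold deg at *; omega)
    obtain ⟨c, d, hcd, hNz⟩ :=
      card_eq_two.1 (show #(B.filter (G.Adj z)) = 2 by unfold deg at *; omega)
    have h0 : degSum G B = 0 := by omega
    obtain ⟨p, py, pz, pa, pb, pc, pd⟩ := hsix a b c d 3 1 0 6 5 4 hab hcd hNy hNz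
    have hall : ∀ x ∈ A, x = y ∨ x = z ∨ x = a ∨ x = b ∨ x = c ∨ x = d := by
      intro x hx
      rcases hcases x hx with h | h | h
      · exact .inl h
      · exact .inr (.inl h)
      · have := hcov h0 x h
        simp only [hNy, hNz, mem_insert, mem_singleton] at this
        tauto
    refine hfin p ?_ ?_ ?_ ?_ ?_ fun x hx w hw hxw => absurd hxw (hnone h0 x hx w hw)
    · intro u hu v hv huv
      rcases hall u hu with h | h | h | h | h | h <;>
        rcases hall v hv with h' | h' | h' | h' | h' | h' <;> rw [h, h'] at huv ⊢ <;> omega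
    · intro u hu
      rcases hall u hu with h | h | h | h | h | h <;> rw [h] <;> omega
    · intro h
      exact absurd h hadj
    · rw [hNy]
      simp only [mem_insert, mem_singleton, forall_eq_or_imp, forall_eq]
      omega
    · rw [hNz]
      simp only [mem_insert, mem_singleton, forall_eq_or_imp, forall_eq]
      omega

/-- At most two vertices, `y` and `z`, are not leaves. -/
lemma placeable_of_deg_le_one {A : Finset V} {m : ℕ} (y z : V) (hm : 6 ≤ m) (hAm : #A ≤ m)
    (h1 : ∀ v ∈ A, v ≠ y → v ≠ z → deg G A v ≤ 1) (h5 : ∀ v ∈ A, deg G A v + 5 ≤ m)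
    (hs : degSum G A + 6 ≤ 2 * m) : Placeable G A m := by
  induction A using Finset.strongInduction generalizing m with
  | H A ih =>
    by_cases hA : ¬ NoIsolated G A
    · simp only [NoIsolated, not_forall, not_not] at hA
      obtain ⟨u, hu, hu0⟩ := hA
      have hc := card_erase_add_one hu
      have hd := degSum_erase (G := G) hu
      refine .of_erase_same hu (by omega) (ih _ (erase_ssubset hu) hm (by omega) ?_ ?_ (by omega))
      · exact fun v hv hvy hvz =>
          (deg_mono (erase_subset _ _) v).trans (h1 v (mem_of_mem_erase hv) hvy hvz)
      · intro v hv
        have := h5 v (mem_of_mem_erase hv)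
        have := deg_mono (G := G) (erase_subset u A) v
        omega
    rw [not_not] at hA
    by_cases hm7 : m = 6
    · subst hm7
      have := card_le_degSum hA
      exact placeable_six_of_matching hA (fun v hv => by have := h5 v hv; omega) (by omega)
    by_cases hrem : ∃ u ∈ A, deg G A u = 1 ∧ ∀ v ∈ A.erase u, deg G (A.erase u) v + 6 ≤ m
    · obtain ⟨u, hu, hu1, hrem⟩ := hrem
      have hc := card_erase_add_one hu
      have hd := degSum_erase (G := G) hu
      refine .of_erase_pred hu (by omega)
        (ih _ (erase_ssubset hu) (by omega) (by omega) ?_ ?_ (by omega))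
      · exact fun v hv hvy hvz =>
          (deg_mono (erase_subset _ _) v).trans (h1 v (mem_of_mem_erase hv) hvy hvz)
      · intro v hv
        have := hrem v hv
        omega
    push Not at hrem
    have key : ∀ u ∈ A, deg G A u = 1 →
        ∃ t ∈ A, (t = y ∨ t = z) ∧ deg G A t + 5 = m ∧ ¬ G.Adj t u := by
      intro u hu hu1
      obtain ⟨t, ht, htm⟩ := hrem u hu hu1
      have htA := mem_of_mem_erase ht
      have h2 := h5 t htA
      have h3 := deg_mono (G := G) (erase_subset u A) t
      refine ⟨t, htA, ?_, by omega, fun h => ?_⟩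
      · by_contra! h
        have := h1 t htA h.1 h.2
        omega
      · have := deg_erase_of_adj hu h
        omega
    have main : ∀ y z : V, (∀ v ∈ A, v ≠ y → v ≠ z → deg G A v ≤ 1) → y ∈ A →
        deg G A y + 5 = m → (∀ u ∈ A, deg G A u = 1 →
          ∃ t ∈ A, (t = y ∨ t = z) ∧ deg G A t + 5 = m ∧ ¬ G.Adj t u) → Placeable G A m := by
      intro y z h1 hy hym key
      obtain ⟨w, hw, hwz⟩ := exists_mem_ne (s := A.filter (G.Adj y))
        (by unfold deg at hym; omega) z
      rw [mem_filter] at hw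
      have hw1 := h1 w hw.1 hw.2.ne' hwz
      have hw0 := hA w hw.1
      obtain ⟨t, htA, ht, htm, htw⟩ := key w hw.1 (by omega)
      have hty : t ≠ y := fun h => htw (h ▸ hw.2)
      obtain rfl : t = z := ht.resolve_left hty
      exact placeable_of_two_centres hA (by omega) hy htA hty.symm hym htm h1 hs
    rcases A.eq_empty_or_nonempty with rfl | ⟨a, ha⟩
    · exact .of_three_mul_card_le (by simp)
    by_cases hleaf : ∃ u ∈ A, deg G A u = 1
    · obtain ⟨u, hu, hu1⟩ := hleaf
      obtain ⟨t, htA, rfl | rfl, htm, htu⟩ := key u hu hu1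
      · exact main t z h1 htA htm key
      · exact main t y (fun v hv h h' => h1 v hv h' h) htA htm
          fun u hu hu1 => by simpa only [or_comm] using key u hu hu1
    push Not at hleaf
    have hsub : A ⊆ {y, z} := by
      intro v hv
      by_contra h
      simp only [mem_insert, mem_singleton, not_or] at h
      have := h1 v hv h.1 h.2
      have := hA v hv
      have := hleaf v hv
      omega
    have := (card_le_card hsub).trans card_le_two
    exact .of_three_mul_card_le (by omega)

lemma placeable_of_card_filter_le_two {A : Finset V} {m : ℕ} (hm : 6 ≤ m) (hAm : #A ≤ m)
    (h2 : #(A.filter fun v => 2 ≤ deg G A v) ≤ 2) (h5 : ∀ v ∈ A, deg G A v + 5 ≤ m)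
    (hs : degSum G A + 6 ≤ 2 * m) : Placeable G A m := by
  rcases A.eq_empty_or_nonempty with rfl | ⟨a, ha⟩
  · exact .of_three_mul_card_le (by simp)
  obtain ⟨y, z, hyz⟩ : ∃ y z : V, (A.filter fun v => 2 ≤ deg G A v) ⊆ {y, z} := by
    have h : #(A.filter fun v => 2 ≤ deg G A v) = 0 ∨ #(A.filter fun v => 2 ≤ deg G A v) = 1 ∨
        #(A.filter fun v => 2 ≤ deg G A v) = 2 := by omega
    rcases h with h | h | h
    · rw [card_eq_zero] at h
      exact ⟨a, a, by simp [h]⟩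
    · obtain ⟨y, hy⟩ := card_eq_one.1 h
      exact ⟨y, y, by simp [hy]⟩
    · obtain ⟨y, z, -, hy⟩ := card_eq_two.1 h
      exact ⟨y, z, hy.subset⟩
  refine placeable_of_deg_le_one y z hm hAm (fun v hv hvy hvz => ?_) h5 hs
  by_contra h
  have := hyz (mem_filter.2 ⟨hv, show 2 ≤ deg G A v by omega⟩)
  simp [hvy, hvz] at this

/-- Removal of leaves at a common neighbour. -/
lemma leaves_removal {A L : Finset V} {x : V} (hx : x ∈ A) (hL : L ⊆ A.filter (G.Adj x))
    (h1 : ∀ l ∈ L, deg G A l ≤ 1) :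
    degSum G A = degSum G (A \ L) + 2 * #L ∧ deg G A x = deg G (A \ L) x + #L ∧
      ∀ m, #L + 5 ≤ m → Placeable G (A \ L) (m - #L) → Placeable G A m := by
  induction L using Finset.induction_on generalizing A with
  | empty => simp
  | insert u L hu ih =>
    obtain ⟨huA, hxu⟩ := mem_filter.1 (hL (mem_insert_self u L))
    have hLA : ∀ l ∈ L, l ∈ A ∧ G.Adj x l := fun l hl =>
      mem_filter.1 (hL (mem_insert_of_mem hl))
    have hsd : A.erase u \ L = A \ insert u L := by
      ext v
      simp
      tauto
    obtain ⟨i1, i2, i3⟩ := ih (A := A.erase u) (mem_erase.2 ⟨hxu.ne, hx⟩)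
      (fun l hl => by
        have hlu : l ≠ u := fun h => hu (h ▸ hl)
        simp [hlu, hLA l hl])
      (fun l hl => (deg_mono (erase_subset _ _) l).trans (h1 l (mem_insert_of_mem hl)))
    rw [hsd] at i1 i2 i3
    have hd := degSum_erase (G := G) huA
    have hdx := deg_erase_of_adj huA hxu
    have hu1 := h1 u (mem_insert_self u L)
    have hu0 : deg G A u ≠ 0 := card_ne_zero.2 ⟨x, by simp [hx, hxu.symm]⟩
    rw [card_insert_of_notMem hu]
    refine ⟨by omega, by omega, fun m hm h => .of_erase_pred huA (by omega) (i3 _ (by omega) ?_)⟩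
    rwa [Nat.sub_sub, Nat.add_comm 1]

lemma card_add_mul_card_filter_le {A : Finset V} (hA : NoIsolated G A) (d : ℕ) {x : V}
    (hx : x ∈ A.filter fun v => d + 1 ≤ deg G A v) :
    deg G A x + #A + d * #(A.filter fun v => d + 1 ≤ deg G A v) ≤ degSum G A + d + 1 := by
  have hxA := (mem_filter.1 hx).1
  have hxd := (mem_filter.1 hx).2
  have h : ∀ v ∈ A.erase x, (1 + if d + 1 ≤ deg G A v then d else 0) ≤ deg G A v := by
    intro v hv
    have := hA v (mem_of_mem_erase hv)
    split_ifs <;> omega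
  have h1 := sum_le_sum h
  have h2 := add_sum_erase A (deg G A) hxA
  have h3 := add_sum_erase A (fun v => 1 + if d + 1 ≤ deg G A v then d else 0) hxA
  have h4 : ∑ v ∈ A, (1 + if d + 1 ≤ deg G A v then d else 0) =
      #A + d * #(A.filter fun v => d + 1 ≤ deg G A v) := by
    rw [sum_add_distrib, ← sum_filter, sum_const, sum_const, smul_eq_mul, smul_eq_mul, mul_one,
      mul_comm d]
  simp only [if_pos hxd] at h3
  unfold degSum
  omega

lemma card_inter_filter_lt {A H : Finset V} {x : V} (hx : x ∈ H) :
    #(A.filter (G.Adj x) ∩ H) < #H :=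
  card_lt_card ⟨inter_subset_right, fun h => by simpa using h hx⟩

/-- Three vertices that are not leaves. -/
lemma placeable_of_three_centres {A : Finset V} {j : ℕ}
    (hH : #(A.filter fun v => 2 ≤ deg G A v) = 3) (hAm : #A ≤ 12 + j) {x : V} (hx : x ∈ A)
    (hxj : deg G A x = j + 2) (h6 : ∀ v ∈ A, deg G A v ≤ 6) (hs : degSum G A ≤ 20 + 2 * j) :
    Placeable G A (12 + j) := by
  set H := A.filter fun v => 2 ≤ deg G A v with hHdef
  have hxH : x ∈ H := mem_filter.2 ⟨hx, by omega⟩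
  have hlt := card_inter_filter_lt (G := G) (A := A) hxH
  have hcard := card_sdiff_add_card_inter (A.filter (G.Adj x)) H
  obtain ⟨L, hL, hLj⟩ := exists_subset_card_eq (s := A.filter (G.Adj x) \ H) (n := j)
    (by unfold deg at hxj; omega)
  have hL1 : ∀ l ∈ L, deg G A l ≤ 1 := by
    intro l hl
    have := mem_sdiff.1 (hL hl)
    rw [hHdef, mem_filter, mem_filter] at this
    by_contra h
    exact this.2 ⟨this.1.1, by omega⟩
  have hLx : x ∉ L := fun h => by
    have := mem_sdiff.1 (hL h)
    exact this.2 hxH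
  have hLA : L ⊆ A := fun l hl => (mem_filter.1 (mem_sdiff.1 (hL hl)).1).1
  obtain ⟨e1, e2, e3⟩ := leaves_removal hx (hL.trans sdiff_subset) hL1
  have hxL : x ∈ A \ L := mem_sdiff.2 ⟨hx, hLx⟩
  have hc := card_erase_add_one hxL
  have hc' := card_sdiff_of_subset hLA
  have hd := degSum_erase (G := G) hxL
  have hsub : (A \ L).erase x ⊆ A := (erase_subset _ _).trans sdiff_subset
  refine e3 _ (by omega) (.of_erase_pred hxL (by omega) ?_)
  refine placeable_of_card_filter_le_two (by omega) (by omega) ?_ ?_ (by omega)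
  · have : (((A \ L).erase x).filter fun v => 2 ≤ deg G ((A \ L).erase x) v) ⊆ H.erase x := by
      intro v hv
      rw [mem_filter] at hv
      exact mem_erase.2 ⟨ne_of_mem_erase hv.1, mem_filter.2
        ⟨hsub hv.1, hv.2.trans (deg_mono hsub v)⟩⟩
    have h1 := card_le_card this
    have h2 := card_erase_add_one hxH
    omega
  · intro v hv
    have h1 := h6 v (hsub hv)
    have h2 := deg_mono (G := G) hsub v
    omega

lemma placeable_fourteen {A : Finset V} (hA : NoIsolated G A) (h9 : 9 ≤ #A) (hA14 : #A ≤ 14)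
    (hs : degSum G A ≤ 20) (hdeg : ∀ v ∈ A, deg G A v ≤ 9) : Placeable G A 14 := by
  by_cases h10 : #A ≤ 10
  · exact placeable_fourteen_of_degSum_le_twenty hA (by omega) (by omega) hs
  by_cases h23 : ∃ u ∈ A, deg G A u = 2 ∨ deg G A u = 3
  · obtain ⟨u, hu, h23⟩ := h23
    have hc := card_erase_add_one hu
    have hd := degSum_erase (G := G) hu
    have hcore := card_core_erase hA hu
    exact .of_erase_pred hu (by omega)
      (placeable_of_core (by omega) (by omega) (by omega) (by omega))
  push Not at h23
  have hfil : (A.filter fun v => 2 ≤ deg G A v) = A.filter fun v => 3 + 1 ≤ deg G A v :=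
    filter_congr fun v hv => by
      have := h23 v hv
      omega
  by_cases h2 : #(A.filter fun v => 2 ≤ deg G A v) ≤ 2
  · exact placeable_of_card_filter_le_two (by omega) (by omega) h2
      (fun v hv => by have := hdeg v hv; omega) (by omega)
  have hx4 : ∀ x ∈ A.filter (fun v => 3 + 1 ≤ deg G A v),
      #(A.filter fun v => 3 + 1 ≤ deg G A v) = 3 ∧ deg G A x = 4 := by
    intro x hx
    have h1 := card_add_mul_card_filter_le hA 3 hx
    have h2 := (mem_filter.1 hx).2
    rw [hfil] at *
    omega
  rw [hfil] at h2
  obtain ⟨x, hx⟩ := card_pos.1 (show 0 < #(A.filter fun v => 3 + 1 ≤ deg G A v) by omega)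
  refine placeable_of_three_centres (j := 2) (by rw [hfil]; exact (hx4 x hx).1) (by omega)
    (mem_filter.1 hx).1 (hx4 x hx).2 (fun v hv => ?_) (by omega)
  by_contra h
  have := (hx4 v (mem_filter.2 ⟨hv, by omega⟩)).2
  omega

lemma NoIsolated.erase_leaf {A : Finset V} (hA : NoIsolated G A) {x l : V} (hx : x ∈ A)
    (hl : l ∈ A) (hxl : G.Adj x l) (hl1 : deg G A l ≤ 1) (hx2 : 2 ≤ deg G A x) :
    NoIsolated G (A.erase l) := by
  intro v hv
  by_cases hvl : G.Adj v l
  · obtain rfl := eq_of_deg_le_one hl1 (mem_of_mem_erase hv) hx hvl.symm hxl.symm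
    have := deg_erase_of_adj hl hvl
    omega
  · rw [deg_erase_of_not_adj hvl]
    exact hA v (mem_of_mem_erase hv)

lemma placeable_fifteen_of_deg_eq_two {A : Finset V} (hA : NoIsolated G A) (h12 : 12 ≤ #A)
    (hA15 : #A ≤ 15) (hs : degSum G A ≤ 24) (hdeg : ∀ v ∈ A, deg G A v ≤ 10)
    {u : V} (hu : u ∈ A) (hu2 : deg G A u = 2) : Placeable G A 15 := by
  by_cases hrem : ∃ u ∈ A, deg G A u = 2 ∧ ∀ v ∈ A.erase u, deg G (A.erase u) v ≤ 9
  · obtain ⟨u, hu, hu2, hrem⟩ := hrem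
    have hc := card_erase_add_one hu
    have hd := degSum_erase (G := G) hu
    have hcore := card_core_erase hA hu
    have hsub := core_subset (G := G) (A.erase u)
    have hle := card_le_card hsub
    have hss := degSum_mono (G := G) hsub
    exact .of_erase_pred hu (by omega) (.of_core (by omega) (placeable_fourteen
      (noIsolated_core _) (by omega) (by omega) (by omega)
      fun v hv => (deg_mono hsub v).trans (hrem v (hsub hv))))
  push Not at hrem
  have key : ∀ u ∈ A, deg G A u = 2 →
      ∃ y ∈ A.erase u, 10 ≤ deg G (A.erase u) y ∧ deg G A y = 10 ∧ ¬ G.Adj y u := by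
    intro u hu hu2
    obtain ⟨y, hy, hy10⟩ := hrem u hu hu2
    have h1 := hdeg y (mem_of_mem_erase hy)
    have h2 := deg_mono (G := G) (erase_subset u A) y
    refine ⟨y, hy, by omega, by omega, fun h => ?_⟩
    have := deg_erase_of_adj hu h
    omega
  obtain ⟨y, hy, hy10', hy10, -⟩ := key u hu hu2
  have hyA := mem_of_mem_erase hy
  have e1 := degSum_erase (G := G) hu
  have e2 := degSum_erase (G := G) hy
  have hzero : ∀ v ∈ A, v ≠ y → v ≠ u →
      deg G A v ≤ 2 ∧ (deg G A v = 2 → G.Adj v y) := by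
    intro v hv hvy hvu
    have h0 : deg G ((A.erase u).erase y) v ≤ degSum G ((A.erase u).erase y) :=
      single_le_sum (f := deg G ((A.erase u).erase y)) (fun _ _ => Nat.zero_le _)
        (by simp [hv, hvy, hvu])
    have h1 : deg G A v ≤ deg G (A.erase u) v + 1 := by
      by_cases h : G.Adj v u
      · exact (deg_erase_of_adj hu h).ge
      · rw [deg_erase_of_not_adj h]
        omega
    by_cases h : G.Adj v y
    · have := deg_erase_of_adj hy h
      exact ⟨by omega, fun _ => h⟩
    · have := deg_erase_of_not_adj (A := A.erase u) h
      omega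
  refine placeable_of_deg_le_one y u (by omega) (by omega) (fun v hv hvy hvu => ?_)
    (fun v hv => by have := hdeg v hv; omega) (by omega)
  by_contra hv1
  obtain ⟨hv2, hvadj⟩ := hzero v hv hvy hvu
  obtain ⟨t, ht, -, ht10, htv⟩ := key v hv (by omega)
  by_cases hty : t = y
  · exact htv (hty ▸ (hvadj (by omega)).symm)
  by_cases htu : t = u
  · rw [htu] at ht10
    omega
  · have := (hzero t (mem_of_mem_erase ht) hty htu).1
    omega

lemma placeable_fifteen {A : Finset V} (hA : NoIsolated G A) (h12 : 12 ≤ #A) (hA15 : #A ≤ 15)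
    (hs : degSum G A ≤ 24) (hdeg : ∀ v ∈ A, deg G A v ≤ 10) : Placeable G A 15 := by
  by_cases h3 : ∃ u ∈ A, deg G A u = 3
  · obtain ⟨u, hu, h3⟩ := h3
    have hc := card_erase_add_one hu
    have hd := degSum_erase (G := G) hu
    have hcore := card_core_erase hA hu
    exact .of_erase_pred hu (by omega)
      (placeable_of_core (by omega) (by omega) (by omega) (by omega))
  by_cases h2 : ∃ u ∈ A, deg G A u = 2
  · obtain ⟨u, hu, h2⟩ := h2
    exact placeable_fifteen_of_deg_eq_two hA h12 hA15 hs hdeg hu h2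
  push Not at h2 h3
  have hfil : (A.filter fun v => 2 ≤ deg G A v) = A.filter fun v => 3 + 1 ≤ deg G A v :=
    filter_congr fun v hv => by
      have := h2 v hv
      have := h3 v hv
      omega
  by_cases h4 : ∃ x ∈ A, deg G A x = 4
  · obtain ⟨x, hx, hx4⟩ := h4
    have hxH : x ∈ A.filter fun v => 3 + 1 ≤ deg G A v := mem_filter.2 ⟨hx, by omega⟩
    have h1 := card_add_mul_card_filter_le hA 3 hxH
    have hlt := card_inter_filter_lt (G := G) (A := A) hxH
    have hcard := card_sdiff_add_card_inter (A.filter (G.Adj x))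
      (A.filter fun v => 3 + 1 ≤ deg G A v)
    obtain ⟨l, hl⟩ := card_pos.1 (show 0 < #(A.filter (G.Adj x) \
      A.filter fun v => 3 + 1 ≤ deg G A v) by unfold deg at *; omega)
    rw [← hfil, mem_sdiff, mem_filter, mem_filter] at hl
    obtain ⟨⟨hlA, hxl⟩, hl1⟩ := hl
    have hl2 : deg G A l = 1 := by
      have := hA l hlA
      by_contra h
      exact hl1 ⟨hlA, by omega⟩
    have hA' := hA.erase_leaf hx hlA hxl (by omega) (by omega)
    have hxe : x ∈ A.erase l := mem_erase.2 ⟨hxl.ne, hx⟩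
    have hdx := deg_erase_of_adj hlA hxl
    have hc := card_erase_add_one hlA
    have hc' := card_erase_add_one hxe
    have hd := degSum_erase (G := G) hlA
    have hd' := degSum_erase (G := G) hxe
    have hcore := card_core_erase hA' hxe
    exact .of_erase_pred hlA (by omega) (.of_erase_pred hxe (by omega)
      (placeable_of_core (by omega) (by omega) (by omega) (by omega)))
  push Not at h4
  replace hfil : (A.filter fun v => 2 ≤ deg G A v) = A.filter fun v => 4 + 1 ≤ deg G A v :=
    hfil.trans (filter_congr fun v hv => by
      have := h4 v hv
      omega)
  by_cases hc2 : #(A.filter fun v => 2 ≤ deg G A v) ≤ 2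
  · exact placeable_of_card_filter_le_two (by omega) (by omega) hc2
      (fun v hv => by have := hdeg v hv; omega) (by omega)
  rw [hfil] at hc2
  have hx5 : ∀ x ∈ A.filter (fun v => 4 + 1 ≤ deg G A v),
      #(A.filter fun v => 4 + 1 ≤ deg G A v) = 3 ∧ deg G A x = 5 := by
    intro x hx
    have h1 := card_add_mul_card_filter_le hA 4 hx
    have h2 := (mem_filter.1 hx).2
    omega
  obtain ⟨x, hx⟩ := card_pos.1 (show 0 < #(A.filter fun v => 4 + 1 ≤ deg G A v) by omega)
  refine placeable_of_three_centres (j := 3) (by rw [hfil]; exact (hx5 x hx).1) (by omega)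
    (mem_filter.1 hx).1 (hx5 x hx).2 (fun v hv => ?_) (by omega)
  by_contra h
  have := (hx5 v (mem_filter.2 ⟨hv, by omega⟩)).2
  omega

lemma exists_adj_deg_le_one {A : Finset V} {y : V} (hy : y ∈ A)
    (h : degSum G A < 3 * deg G A y) : ∃ u ∈ A, G.Adj y u ∧ deg G A u ≤ 1 := by
  by_contra! hcon
  have hd := degSum_erase (G := G) hy
  have h1 : #(A.filter (G.Adj y)) * 1 ≤ ∑ v ∈ A.filter (G.Adj y), deg G (A.erase y) v := by
    simpa using card_nsmul_le_sum (A.filter (G.Adj y)) (deg G (A.erase y)) 1 fun v hv => by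
      rw [mem_filter] at hv
      have := hcon v hv.1 hv.2
      have := deg_erase_of_adj hy hv.2.symm
      omega
  have h2 : ∑ v ∈ A.filter (G.Adj y), deg G (A.erase y) v ≤ degSum G (A.erase y) :=
    sum_le_sum_of_subset fun v hv => by
      rw [mem_filter] at hv
      exact mem_erase.2 ⟨hv.2.ne', hv.1⟩
  unfold deg at *
  omega

/-- At most `m - 3` edges and all degrees at most `m - 5`. -/
lemma placeable_of_deg_add_five_le {A : Finset V} {m : ℕ} (hm : 15 ≤ m) (hAm : #A ≤ m)
    (hs : degSum G A + 6 ≤ 2 * m) (h5 : ∀ v ∈ A, deg G A v + 5 ≤ m) : Placeable G A m := by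
  induction A using Finset.strongInduction generalizing m with
  | H A ih =>
    by_cases hA : ¬ NoIsolated G A
    · simp only [NoIsolated, not_forall, not_not] at hA
      obtain ⟨u, hu, hu0⟩ := hA
      have hc := card_erase_add_one hu
      have hd := degSum_erase (G := G) hu
      refine .of_erase_same hu (by omega)
        (ih _ (erase_ssubset hu) hm (by omega) (by omega) fun v hv => ?_)
      have := h5 v (mem_of_mem_erase hv)
      have := deg_mono (G := G) (erase_subset u A) v
      omega
    rw [not_not] at hA
    by_cases hf : #A + 4 ≤ m
    · exact placeable_of_degSum_add_six_le hm hf hs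
    by_cases hm15 : m = 15
    · subst hm15
      exact placeable_fifteen hA (by omega) hAm (by omega)
        fun v hv => by have := h5 v hv; omega
    by_cases hy : ∃ y ∈ A, deg G A y + 5 = m
    · obtain ⟨y, hy, hym⟩ := hy
      obtain ⟨u, hu, hyu, hu1⟩ := exists_adj_deg_le_one (G := G) hy (by omega)
      have hu0 := hA u hu
      have hc := card_erase_add_one hu
      have hd := degSum_erase (G := G) hu
      have hd' := degSum_erase (G := G) hy
      refine .of_erase_pred hu (by omega)
        (ih _ (erase_ssubset hu) (by omega) (by omega) (by omega) fun v hv => ?_)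
      by_cases hvy : v = y
      · rw [hvy]
        have := deg_erase_of_adj hu hyu
        omega
      have h1 := deg_mono (G := G) (erase_subset u A) v
      have h2 : deg G (A.erase y) v ≤ degSum G (A.erase y) :=
        single_le_sum (f := deg G (A.erase y)) (fun _ _ => Nat.zero_le _)
          (mem_erase.2 ⟨hvy, mem_of_mem_erase hv⟩)
      have h3 : deg G A v ≤ deg G (A.erase y) v + 1 := by
        by_cases h : G.Adj v y
        · exact (deg_erase_of_adj hy h).ge
        · rw [deg_erase_of_not_adj h]
          omega
      omega
    push Not at hy
    obtain ⟨u, hu, hmin, hcd, hlt⟩ := exists_min_deg (G := G) (A := A) (card_pos.1 (by omega))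
    have hu0 := hA u hu
    have hu2 : deg G A u ≤ 2 := by
      by_contra h
      have : #A * 3 ≤ #A * deg G A u := Nat.mul_le_mul_left _ (by omega)
      omega
    have hc := card_erase_add_one hu
    have hd := degSum_erase (G := G) hu
    refine .of_erase_pred hu (by omega)
      (ih _ (erase_ssubset hu) (by omega) (by omega) (by omega) fun v hv => ?_)
    have h1 := h5 v (mem_of_mem_erase hv)
    have h2 := hy v (mem_of_mem_erase hv)
    have h3 := deg_mono (G := G) (erase_subset u A) v
    omega

lemma contains_starG {V : Type*} [Fintype V] {F : SimpleGraph V} [DecidableRel F.Adj] {d : ℕ}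
    (v : V) (h : d ≤ F.degree v) : Contains F (starG (d + 1)) := by
  obtain ⟨s, hs, hsd⟩ := exists_subset_card_eq (show d ≤ #(F.neighborFinset v) from h)
  let e := (s.equivFinOfCardEq hsd).symm
  have he : ∀ i, F.Adj v (e i) := fun i => by simpa using hs (e i).2
  refine ⟨⟨Fin.cons v fun i => (e i : V), Fin.cons_injective_iff.2 ⟨?_, ?_⟩⟩, ?_⟩
  · rintro ⟨i, hi⟩
    exact (he i).ne hi.symm
  · exact fun i j hij => e.injective (Subtype.ext hij)
  · intro a b hab
    simp only [starG, SimpleGraph.fromRel_adj] at hab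
    obtain ⟨hne, hab⟩ := hab
    cases a using Fin.cases <;> cases b using Fin.cases <;> simp_all [SimpleGraph.adj_comm]

lemma contains_compl_cycleSq {V : Type*} [Fintype V] [DecidableEq V] {F : SimpleGraph V}
    [DecidableRel F.Adj] {n : ℕ} (hn : 3 ≤ n) (h : Placeable F univ n) :
    Contains (cycleSq n)ᶜ F := by
  obtain ⟨p, hinj, hlt, hadj⟩ := h
  have : NeZero n := ⟨by omega⟩
  have hcast : ∀ a b : V, (p a : ZMod n) = p b → a = b := fun a b hab => by
    rw [ZMod.natCast_eq_natCast_iff', Nat.mod_eq_of_lt (hlt a (mem_univ a)),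
      Nat.mod_eq_of_lt (hlt b (mem_univ b))] at hab
    exact hinj (mem_univ a) (mem_univ b) hab
  have hdiff : ∀ a b : V, F.Adj a b → ∀ c : ℕ, c = 1 ∨ c = 2 → (p b : ZMod n) - p a ≠ c := by
    intro a b hab c hc h
    rw [sub_eq_iff_eq_add', ← Nat.cast_add, ZMod.natCast_eq_natCast_iff',
      Nat.mod_eq_of_lt (hlt b (mem_univ b))] at h
    have ha := hlt a (mem_univ a)
    have hb := hlt b (mem_univ b)
    have h1 := hadj a (mem_univ a) b (mem_univ b) hab
    have h2 := hadj b (mem_univ b) a (mem_univ a) hab.symm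
    by_cases hlt : p a + c < n
    · rw [Nat.mod_eq_of_lt hlt] at h
      omega
    · rw [Nat.mod_eq_sub_mod (by omega), Nat.mod_eq_of_lt (by omega)] at h
      omega
  refine ⟨⟨fun v => p v, hcast⟩, fun a b hab => ?_⟩
  have h1 := hdiff a b hab 1 (.inl rfl)
  have h2 := hdiff a b hab 2 (.inr rfl)
  have h3 := hdiff b a hab.symm 1 (.inl rfl)
  have h4 := hdiff b a hab.symm 2 (.inr rfl)
  push_cast at h1 h2 h3 h4
  rw [SimpleGraph.compl_adj]
  refine ⟨fun h => hab.ne (hcast a b h), ?_⟩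
  simp only [cycleSq, SimpleGraph.fromRel_adj]
  tauto

end CyclePacking

/-- For `n ≥ 15`, the complement of `C_n²` contains a copy of every graph
`F` on `n` vertices with `n − 3` edges, unless `F` contains the star `S_{n−3}` as a
subgraph. -/
theorem stmt4 (n : ℕ) (hn : 15 ≤ n) (F : SimpleGraph (Fin n))
    (he : F.edgeSet.ncard = n - 3) :
    Contains (cycleSq n)ᶜ F ∨ Contains F (starG (n - 3)) := by
  classical
  by_cases h : ∃ v, n - 4 ≤ F.degree v
  · obtain ⟨v, hv⟩ := h
    right
    rw [show n - 3 = n - 4 + 1 by omega]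
    exact CyclePacking.contains_starG v hv
  push Not at h
  left
  have hdeg : ∀ v, CyclePacking.deg F Finset.univ v = F.degree v := fun v => by
    rw [CyclePacking.deg, ← SimpleGraph.card_neighborFinset_eq_degree,
      SimpleGraph.neighborFinset_eq_filter]
  have hsum : CyclePacking.degSum F Finset.univ = 2 * (n - 3) := by
    rw [← he, ← SimpleGraph.coe_edgeFinset, Set.ncard_coe_finset,
      ← SimpleGraph.sum_degrees_eq_twice_card_edges]
    exact Finset.sum_congr rfl fun v _ => hdeg v
  refine CyclePacking.contains_compl_cycleSq (by omega)
    (CyclePacking.placeable_of_deg_add_five_le hn (by simp) (by omega) fun v _ => ?_)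
  have := h v
  rw [hdeg]
  omega
end
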